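/- There are no rational numbers X, Y satisfying Y² = X⁶ - 6X⁵ + 15X⁴ + 40X³ - 24X + 12. (Equivalently, the only rational points on the genus-two hyperelliptic curve C₂ defined by this equation are the two points at infinity.) -/

import Mathlib

/-- Elements `a + b v + c w` of the free module over `A` on `1, v, w`, where `v` is a root of
`x ^ 3 = 3 * x + 1` and `w = 2 - v ^ 2` is its conjugate. -/
@[ext]
structure Cub (A : Type*) where
  /-- The coordinate along `1`. -/
  a : A
  /-- The coordinate along `v`. -/
  b : A
  /-- The coordinate along `w`. -/
  c : A

namespace Cub

instance {A : Type*} [DecidableEq A] : DecidableEq (Cub A) := fun x y =>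
  decidable_of_iff (x.a = y.a ∧ x.b = y.b ∧ x.c = y.c) (Cub.ext_iff).symm

section Ring

variable {A : Type*} [CommRing A]

instance : Zero (Cub A) := ⟨⟨0, 0, 0⟩⟩
instance : One (Cub A) := ⟨⟨1, 0, 0⟩⟩
instance : Add (Cub A) := ⟨fun x y => ⟨x.a + y.a, x.b + y.b, x.c + y.c⟩⟩
instance : Neg (Cub A) := ⟨fun x => ⟨-x.a, -x.b, -x.c⟩⟩
instance : Sub (Cub A) := ⟨fun x y => ⟨x.a - y.a, x.b - y.b, x.c - y.c⟩⟩
instance : Mul (Cub A) := ⟨fun x y =>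
  ⟨x.a * y.a + 2 * x.b * y.b + 2 * x.c * y.c - (x.b * y.c + x.c * y.b),
   x.a * y.b + x.b * y.a - (x.b * y.c + x.c * y.b) + x.c * y.c,
   x.a * y.c + x.c * y.a - x.b * y.b + x.c * y.c⟩⟩
instance : NatCast (Cub A) := ⟨fun n => ⟨n, 0, 0⟩⟩
instance : IntCast (Cub A) := ⟨fun n => ⟨n, 0, 0⟩⟩

@[simp] lemma zero_a : (0 : Cub A).a = 0 := rfl
@[simp] lemma zero_b : (0 : Cub A).b = 0 := rfl
@[simp] lemma zero_c : (0 : Cub A).c = 0 := rfl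
@[simp] lemma one_a : (1 : Cub A).a = 1 := rfl
@[simp] lemma one_b : (1 : Cub A).b = 0 := rfl
@[simp] lemma one_c : (1 : Cub A).c = 0 := rfl
@[simp] lemma add_a (x y : Cub A) : (x + y).a = x.a + y.a := rfl
@[simp] lemma add_b (x y : Cub A) : (x + y).b = x.b + y.b := rfl
@[simp] lemma add_c (x y : Cub A) : (x + y).c = x.c + y.c := rfl
@[simp] lemma neg_a (x : Cub A) : (-x).a = -x.a := rfl
@[simp] lemma neg_b (x : Cub A) : (-x).b = -x.b := rfl
@[simp] lemma neg_c (x : Cub A) : (-x).c = -x.c := rfl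
@[simp] lemma sub_a (x y : Cub A) : (x - y).a = x.a - y.a := rfl
@[simp] lemma sub_b (x y : Cub A) : (x - y).b = x.b - y.b := rfl
@[simp] lemma sub_c (x y : Cub A) : (x - y).c = x.c - y.c := rfl
@[simp] lemma mul_a (x y : Cub A) : (x * y).a =
    x.a * y.a + 2 * x.b * y.b + 2 * x.c * y.c - (x.b * y.c + x.c * y.b) := rfl
@[simp] lemma mul_b (x y : Cub A) : (x * y).b =
    x.a * y.b + x.b * y.a - (x.b * y.c + x.c * y.b) + x.c * y.c := rfl
@[simp] lemma mul_c (x y : Cub A) : (x * y).c =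
    x.a * y.c + x.c * y.a - x.b * y.b + x.c * y.c := rfl
@[simp] lemma natCast_a (n : ℕ) : (n : Cub A).a = n := rfl
@[simp] lemma natCast_b (n : ℕ) : (n : Cub A).b = 0 := rfl
@[simp] lemma natCast_c (n : ℕ) : (n : Cub A).c = 0 := rfl
@[simp] lemma intCast_a (n : ℤ) : (n : Cub A).a = n := rfl
@[simp] lemma intCast_b (n : ℤ) : (n : Cub A).b = 0 := rfl
@[simp] lemma intCast_c (n : ℤ) : (n : Cub A).c = 0 := rfl

instance : CommRing (Cub A) where
  add_assoc _ _ _ := by ext <;> simp <;> ring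
  zero_add _ := by ext <;> simp
  add_zero _ := by ext <;> simp
  add_comm _ _ := by ext <;> simp <;> ring
  neg_add_cancel _ := by ext <;> simp
  sub_eq_add_neg _ _ := by ext <;> simp <;> ring
  mul_assoc _ _ _ := by ext <;> simp <;> ring
  one_mul _ := by ext <;> simp
  mul_one _ := by ext <;> simp
  mul_comm _ _ := by ext <;> simp <;> ring
  left_distrib _ _ _ := by ext <;> simp <;> ring
  right_distrib _ _ _ := by ext <;> simp <;> ring
  zero_mul _ := by ext <;> simp
  mul_zero _ := by ext <;> simp
  nsmul := nsmulRec
  zsmul := zsmulRec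
  natCast_zero := by ext <;> simp
  natCast_succ _ := by ext <;> simp
  intCast_ofNat _ := by ext <;> simp
  intCast_negSucc _ := by ext <;> simp

@[simp] lemma ofNat_a (n : ℕ) [n.AtLeastTwo] :
    (ofNat(n) : Cub A).a = (ofNat(n) : A) := by
  rw [← Nat.cast_ofNat, natCast_a, Nat.cast_ofNat]
@[simp] lemma ofNat_b (n : ℕ) [n.AtLeastTwo] : (ofNat(n) : Cub A).b = 0 := by
  rw [← Nat.cast_ofNat, natCast_b]
@[simp] lemma ofNat_c (n : ℕ) [n.AtLeastTwo] : (ofNat(n) : Cub A).c = 0 := by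
  rw [← Nat.cast_ofNat, natCast_c]

/-- The automorphism `v ↦ w ↦ -v - w ↦ v`. -/
def conj : Cub A →+* Cub A where
  toFun x := ⟨x.a, -x.c, x.b - x.c⟩
  map_one' := by ext <;> simp
  map_zero' := by ext <;> simp
  map_add' _ _ := by ext <;> simp <;> ring
  map_mul' _ _ := by ext <;> simp <;> ring

@[simp] lemma conj_a (x : Cub A) : (conj x).a = x.a := rfl
@[simp] lemma conj_b (x : Cub A) : (conj x).b = -x.c := rfl
@[simp] lemma conj_c (x : Cub A) : (conj x).c = x.b - x.c := rfl

/-- The norm `x * conj x * conj (conj x)`. -/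
def norm : Cub A →* A where
  toFun x := (x * conj x * conj (conj x)).a
  map_one' := by simp
  map_mul' _ _ := by simp; ring

lemma norm_def (x : Cub A) : norm x = (x * conj x * conj (conj x)).a := rfl

lemma coe_norm (x : Cub ℤ) : ((norm x : ℤ) : Cub ℤ) = x * conj x * conj (conj x) := by
  ext <;> simp [norm_def] <;> ring

/-- Functoriality of `Cub` in the coefficient ring. -/
def map {B : Type*} [CommRing B] (f : A →+* B) : Cub A →+* Cub B where
  toFun x := ⟨f x.a, f x.b, f x.c⟩
  map_one' := by ext <;> simp
  map_zero' := by ext <;> simp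
  map_add' _ _ := by ext <;> simp
  map_mul' _ _ := by ext <;> simp [map_ofNat]

/-- The generator `v`. -/
def v : Cub A := ⟨0, 1, 0⟩
/-- The conjugate `w` of `v`. -/
def w : Cub A := ⟨0, 0, 1⟩

@[simp] lemma v_a : (v : Cub A).a = 0 := rfl
@[simp] lemma v_b : (v : Cub A).b = 1 := rfl
@[simp] lemma v_c : (v : Cub A).c = 0 := rfl
@[simp] lemma w_a : (w : Cub A).a = 0 := rfl
@[simp] lemma w_b : (w : Cub A).b = 0 := rfl
@[simp] lemma w_c : (w : Cub A).c = 1 := rfl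

end Ring

lemma exists_theta : ∃ θ : ℝ, (1.87 < θ ∧ θ < 1.88) ∧ θ ^ 3 = 3 * θ + 1 := by
  have h := intermediate_value_Ioo (f := fun x : ℝ => x ^ 3 - 3 * x - 1) (a := 1.87) (b := 1.88)
    (by norm_num) (by fun_prop)
  obtain ⟨θ, hθ, h0⟩ := h (show (0 : ℝ) ∈ _ by constructor <;> norm_num)
  exact ⟨θ, hθ, by simp only at h0; linarith⟩

/-- The largest root of `x ^ 3 = 3 * x + 1`. -/
noncomputable def theta : ℝ := exists_theta.choose

lemma lt_theta : 1.87 < theta := exists_theta.choose_spec.1.1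
lemma theta_lt : theta < 1.88 := exists_theta.choose_spec.1.2
lemma theta_cub : theta ^ 3 = 3 * theta + 1 := exists_theta.choose_spec.2

/-- The real embedding sending `v` to `theta`. -/
noncomputable def phi : Cub ℤ →+* ℝ where
  toFun x := x.a + x.b * theta + x.c * (2 - theta ^ 2)
  map_one' := by simp
  map_zero' := by simp
  map_add' _ _ := by simp; ring
  map_mul' x y := by
    simp
    linear_combination (-(x.c * y.c : ℝ) * theta + (x.b * y.c + x.c * y.b : ℝ)) * theta_cub

lemma phi_apply (x : Cub ℤ) : phi x = x.a + x.b * theta + x.c * (2 - theta ^ 2) := rfl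

lemma phi_intCast (n : ℤ) : phi n = n := by simp

lemma phi_norm (x : Cub ℤ) : ((norm x : ℤ) : ℝ) = phi x * phi (conj x) * phi (conj (conj x)) := by
  rw [← map_mul, ← map_mul, ← coe_norm, phi_intCast]

lemma sum_phi_sq (x : Cub ℤ) : phi x ^ 2 + phi (conj x) ^ 2 + phi (conj (conj x)) ^ 2 =
    3 * (x.a ^ 2 + 2 * (x.b ^ 2 - x.b * x.c + x.c ^ 2)) := by
  simp only [phi_apply, conj_a, conj_b, conj_c]
  push_cast
  have h := theta_cub
  have h4 : theta ^ 4 = 3 * theta ^ 2 + theta := by linear_combination theta * h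
  ring_nf
  rw [h4, h]
  ring

lemma amgm3 {p q r : ℝ} (hp : 0 ≤ p) (hq : 0 ≤ q) (hr : 0 ≤ r) :
    27 * (p * q * r) ≤ (p + q + r) ^ 3 := by
  nlinarith [mul_nonneg hp (sq_nonneg (q - r)), mul_nonneg hq (sq_nonneg (p - r)),
    mul_nonneg hr (sq_nonneg (q - p)), mul_nonneg hp (sq_nonneg (p - r)),
    mul_nonneg hp (sq_nonneg (p - q)), mul_nonneg hq (sq_nonneg (p - q)),
    mul_nonneg hq (sq_nonneg (q - r)), mul_nonneg hr (sq_nonneg (q - r)),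
    mul_nonneg hr (sq_nonneg (p - r))]

lemma norm_sq_le (x : Cub ℤ) :
    norm x ^ 2 ≤ (x.a ^ 2 + 2 * (x.b ^ 2 - x.b * x.c + x.c ^ 2)) ^ 3 := by
  have h := amgm3 (sq_nonneg (phi x)) (sq_nonneg (phi (conj x))) (sq_nonneg (phi (conj (conj x))))
  rw [sum_phi_sq, ← mul_pow, ← mul_pow, ← phi_norm] at h
  have : ((norm x ^ 2 : ℤ) : ℝ) ≤
      ((x.a ^ 2 + 2 * (x.b ^ 2 - x.b * x.c + x.c ^ 2)) ^ 3 : ℤ) := by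
    push_cast
    nlinarith [h]
  exact_mod_cast this

lemma norm_eq (x : Cub ℤ) : norm x = x.a ^ 3 - 3 * x.a * (x.b ^ 2 - x.b * x.c + x.c ^ 2)
    + (x.b ^ 3 - 6 * x.b ^ 2 * x.c + 3 * x.b * x.c ^ 2 + x.c ^ 3) := by
  simp [norm_def]; ring

lemma two_dvd_iff (x : Cub ℤ) : 2 ∣ x ↔ 2 ∣ x.a ∧ 2 ∣ x.b ∧ 2 ∣ x.c := by
  constructor
  · rintro ⟨y, rfl⟩; simp
  · rintro ⟨⟨i, hi⟩, ⟨j, hj⟩, ⟨k, hk⟩⟩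
    exact ⟨⟨i, j, k⟩, by ext <;> simp [*]⟩

lemma two_dvd_iff_norm (x : Cub ℤ) : 2 ∣ x ↔ 2 ∣ norm x := by
  rw [two_dvd_iff, norm_eq]
  have key : ∀ a b c : ZMod 2, (a = 0 ∧ b = 0 ∧ c = 0) ↔ a ^ 3 - 3 * a * (b ^ 2 - b * c + c ^ 2)
    + (b ^ 3 - 6 * b ^ 2 * c + 3 * b * c ^ 2 + c ^ 3) = 0 := by decide
  have := key x.a x.b x.c
  have c2 (z : ℤ) : 2 ∣ z ↔ (z : ZMod 2) = 0 := by
    rw [ZMod.intCast_zmod_eq_zero_iff_dvd]; rfl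
  rw [c2, c2, c2, c2, this]
  push_cast
  rfl

lemma norm_eq_zero {x : Cub ℤ} (h : norm x = 0) : x = 0 := by
  induction hn : x.a.natAbs + x.b.natAbs + x.c.natAbs using Nat.strong_induction_on generalizing x
    with | _ n ih
  obtain ⟨y, rfl⟩ := (two_dvd_iff_norm x).2 (by simp [h])
  have hy : norm y = 0 := by
    rw [map_mul] at h
    have : norm (2 : Cub ℤ) = 8 := by simp [norm_eq]
    simpa [this] using h
  by_contra hne
  have h0 : y.a.natAbs + y.b.natAbs + y.c.natAbs ≠ 0 := by
    intro h0
    apply hne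
    have : y = 0 := by ext <;> simp <;> omega
    simp [this]
  have := ih (y.a.natAbs + y.b.natAbs + y.c.natAbs)
    (by simp [Int.natAbs_mul] at hn; omega) hy rfl
  simp [this] at hne

instance : Nontrivial (Cub ℤ) := ⟨0, 1, fun h => by simpa using congrArg Cub.a h⟩

instance : NoZeroDivisors (Cub ℤ) where
  eq_zero_or_eq_zero_of_mul_eq_zero {x y} h := by
    have := congrArg norm h
    rw [map_mul] at this
    have h0 : norm (0 : Cub ℤ) = 0 := by simp [norm_eq]
    rcases mul_eq_zero.1 (this.trans h0) with h | h
    · exact Or.inl (norm_eq_zero h)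
    · exact Or.inr (norm_eq_zero h)

instance : IsDomain (Cub ℤ) := NoZeroDivisors.to_isDomain _

lemma exists_round {M : ℤ} (hM : 0 < M) (a : ℤ) : ∃ q, |2 * (a - M * q)| ≤ M := by
  refine ⟨(2 * a + M) / (2 * M), ?_⟩
  have h1 := Int.emod_add_mul_ediv (2 * a + M) (2 * M)
  have h2 := Int.emod_nonneg (2 * a + M) (by omega : 2 * M ≠ 0)
  have h3 := Int.emod_lt_of_pos (2 * a + M) (by omega : 0 < 2 * M)
  rw [abs_le]
  constructor <;> linarith

/-- Rounding to the hexagonal lattice. -/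
lemma exists_hex_round {M : ℤ} (hM : 0 < M) (b c : ℤ) : ∃ q r,
    3 * ((b - M * q) ^ 2 - (b - M * q) * (c - M * r) + (c - M * r) ^ 2) ≤ M ^ 2 := by
  obtain ⟨q, hq⟩ := exists_round hM b
  obtain ⟨r, hr⟩ := exists_round hM c
  obtain ⟨x, hx⟩ : ∃ x, x = b - M * q := ⟨_, rfl⟩
  obtain ⟨y, hy⟩ : ∃ y, y = c - M * r := ⟨_, rfl⟩
  suffices h : ∃ q' r', 3 * ((x - M * q') ^ 2 - (x - M * q') * (y - M * r') + (y - M * r') ^ 2)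
      ≤ M ^ 2 by
    obtain ⟨q', r', h⟩ := h
    refine ⟨q + q', r + r', ?_⟩
    convert h using 2
    rw [hx, hy]; ring
  rw [← hx, abs_le] at hq
  rw [← hy, abs_le] at hr
  clear hx hy
  have main : ∀ s t : ℤ, 0 ≤ s → 0 ≤ t → 2 * s ≤ M → 2 * t ≤ M →
      3 * (s ^ 2 + s * t + t ^ 2) ≤ M ^ 2 ∨ 3 * ((s - M) ^ 2 + (s - M) * t + t ^ 2) ≤ M ^ 2 ∨
      3 * (s ^ 2 + s * (t - M) + (t - M) ^ 2) ≤ M ^ 2 := by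
    intro s t hs ht hs2 ht2
    by_contra! h
    obtain ⟨h1, h2, h3⟩ := h
    have e1 := mul_le_mul_of_nonneg_left h1.le (by linarith : 0 ≤ M - s - t)
    have e2 := mul_le_mul_of_nonneg_left h2.le hs
    have e3 := mul_le_mul_of_nonneg_left h3.le ht
    have e4 : (M - s - t) * (3 * (s ^ 2 + s * t + t ^ 2) - M ^ 2) + s * (3 * ((s - M) ^ 2 + (s - M) * t + t ^ 2) - M ^ 2)
       + t * (3 * (s ^ 2 + s * (t - M) + (t - M) ^ 2) - M ^ 2) = M * (3 * M * (s + t) - 3 * (s ^ 2 + s * t + t ^ 2) - M ^ 2) := by ring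
    have e5 : 4 * (3 * M * (s + t) - 3 * (s ^ 2 + s * t + t ^ 2) - M ^ 2) = -(9 * (s + t) ^ 2 - 12 * M * (s + t) + 4 * M ^ 2) - 3 * (s - t) ^ 2 := by ring
    have e6 : 9 * (s + t) ^ 2 - 12 * M * (s + t) + 4 * M ^ 2 = (3 * (s + t) - 2 * M) ^ 2 := by ring
    have e7 : 0 ≤ M * (3 * M * (s + t) - 3 * (s ^ 2 + s * t + t ^ 2) - M ^ 2) := by
      rw [← e4]; nlinarith
    have e8 : 0 ≤ 3 * M * (s + t) - 3 * (s ^ 2 + s * t + t ^ 2) - M ^ 2 :=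
      nonneg_of_mul_nonneg_right e7 hM
    have e9 : s - t = 0 := by
      rw [← sq_eq_zero_iff]; nlinarith [sq_nonneg (3 * (s + t) - 2 * M), sq_nonneg (s - t)]
    have e10 : 3 * (s + t) - 2 * M = 0 := by
      rw [← sq_eq_zero_iff]; nlinarith [sq_nonneg (3 * (s + t) - 2 * M), sq_nonneg (s - t)]
    have : s = t := by linarith
    subst this
    have : M = 3 * s := by linarith
    subst this
    nlinarith
  have same : ∀ s t : ℤ, 0 ≤ s → 0 ≤ t → 2 * s ≤ M → 2 * t ≤ M →
      3 * (s ^ 2 - s * t + t ^ 2) ≤ M ^ 2 := by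
    intro s t hs ht hs2 ht2
    rcases le_total s t with h | h
    · nlinarith [mul_nonneg hs (sub_nonneg.2 h)]
    · nlinarith [mul_nonneg ht (sub_nonneg.2 h)]
  rcases le_total 0 x with h1 | h1 <;> rcases le_total 0 y with h2 | h2
  · exact ⟨0, 0, by have := same x y h1 h2 (by linarith) (by linarith); linarith⟩
  · rcases main x (-y) h1 (by linarith) (by linarith) (by linarith) with h | h | h
    · exact ⟨0, 0, by linarith⟩
    · exact ⟨1, 0, by linarith⟩
    · exact ⟨0, -1, by linarith⟩
  · rcases main (-x) y (by linarith) (by linarith) (by linarith) (by linarith) with h | h | h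
    · exact ⟨0, 0, by linarith⟩
    · exact ⟨-1, 0, by linarith⟩
    · exact ⟨0, 1, by linarith⟩
  · exact ⟨0, 0, by
      have := same (-x) (-y) (by linarith) (by linarith) (by linarith) (by linarith); linarith⟩

lemma exists_quotient (x : Cub ℤ) {y : Cub ℤ} (hy : y ≠ 0) :
    ∃ q, norm (x - y * q) ^ 2 < norm y ^ 2 := by
  have hN : norm y ≠ 0 := fun h => hy (norm_eq_zero h)
  have aux : ∀ g : Cub ℤ, ∃ q : Cub ℤ, norm (g - ((norm y : ℤ) : Cub ℤ) * q) ^ 2 < (norm y) ^ 6 := by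
    intro g
    have aux' : ∀ M : ℤ, 0 < M → ∃ q : Cub ℤ, norm (g - (M : Cub ℤ) * q) ^ 2 < M ^ 6 := by
      intro M hM
      obtain ⟨q₀, h₀⟩ := exists_round hM g.a
      obtain ⟨q₁, q₂, h₁⟩ := exists_hex_round hM g.b g.c
      refine ⟨⟨q₀, q₁, q₂⟩, (norm_sq_le _).trans_lt ?_⟩
      simp only [sub_a, sub_b, sub_c, mul_a, mul_b, mul_c, intCast_a, intCast_b, intCast_c,
        zero_mul, mul_zero, add_zero, sub_zero, Int.cast_id]
      have h2 : 4 * (g.a - M * q₀) ^ 2 ≤ M ^ 2 := by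
        have := sq_le_sq' (by linarith [(abs_le.1 h₀).1]) (abs_le.1 h₀).2
        linarith
      set Q := (g.a - M * q₀) ^ 2 + 2 * ((g.b - M * q₁) ^ 2 - (g.b - M * q₁) * (g.c - M * q₂)
        + (g.c - M * q₂) ^ 2) with hQ
      have h3 : Q < M ^ 2 := by nlinarith [pow_pos hM 2]
      have h4 : 0 ≤ Q := by
        nlinarith [sq_nonneg (g.a - M * q₀), sq_nonneg (g.b - M * q₁ - (g.c - M * q₂)),
          sq_nonneg (g.b - M * q₁), sq_nonneg (g.c - M * q₂)]
      calc _ = Q ^ 3 := by rw [hQ]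
        _ < (M ^ 2) ^ 3 := by gcongr
        _ = M ^ 6 := by ring
    rcases lt_or_gt_of_ne hN with h | h
    · obtain ⟨q, hq⟩ := aux' (-norm y) (by linarith)
      refine ⟨-q, ?_⟩
      convert hq using 1
      · congr 2; push_cast; ring
      · ring
    · exact aux' _ h
  obtain ⟨q, hq⟩ := aux (x * (conj y * conj (conj y)))
  refine ⟨q, ?_⟩
  have e : x * (conj y * conj (conj y)) - ((norm y : ℤ) : Cub ℤ) * q =
      (x - y * q) * (conj y * conj (conj y)) := by rw [coe_norm]; ring
  have e2 : norm (conj y * conj (conj y)) = norm y ^ 2 := by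
    simp [norm_def]; ring
  rw [e, map_mul, e2] at hq
  have : 0 < norm y ^ 4 := by positivity
  have h6 : norm (x - y * q) ^ 2 * norm y ^ 4 < norm y ^ 2 * norm y ^ 4 := by
    calc _ = (norm (x - y * q) * norm y ^ 2) ^ 2 := by ring
      _ < _ := hq
      _ = _ := by ring
  exact lt_of_mul_lt_mul_right h6 this.le

open Classical in
noncomputable instance : EuclideanDomain (Cub ℤ) where
  quotient x y := if h : y = 0 then 0 else (exists_quotient x h).choose
  quotient_zero x := by simp
  remainder x y := if h : y = 0 then x else x - y * (exists_quotient x h).choose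
  quotient_mul_add_remainder_eq x y := by
    by_cases h : y = 0 <;> simp [h]
  r x y := norm x ^ 2 < norm y ^ 2
  r_wellFounded := by
    have : WellFounded (InvImage (· < ·) fun x : Cub ℤ => (norm x ^ 2).toNat) :=
      InvImage.wf _ wellFounded_lt
    refine Subrelation.wf ?_ this
    intro x y h
    have := sq_nonneg (norm x)
    change (norm x ^ 2).toNat < (norm y ^ 2).toNat
    omega
  remainder_lt x y h := by
    simp only [h, dite_false]
    exact (exists_quotient x h).choose_spec
  mul_left_not_lt x y h := by
    have hN : norm y ≠ 0 := fun h' => h (norm_eq_zero h')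
    rw [map_mul, not_lt, mul_pow]
    have : 1 ≤ norm y ^ 2 := by have : 0 < norm y ^ 2 := by positivity
                                omega
    nlinarith [sq_nonneg (norm x)]

lemma phi_v : phi v = theta := by simp [phi_apply]

lemma theta_sq_bounds : 3.49 < theta ^ 2 ∧ theta ^ 2 < 3.54 := by
  constructor <;> nlinarith [lt_theta, theta_lt]

/-- Positivity in all three real embeddings. -/
def TotPos (x : Cub ℤ) : Prop := 0 < phi x ∧ 0 < phi (conj x) ∧ 0 < phi (conj (conj x))

lemma phi_ne_zero {x : Cub ℤ} (hx : norm x ≠ 0) :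
    phi x ≠ 0 ∧ phi (conj x) ≠ 0 ∧ phi (conj (conj x)) ≠ 0 := by
  have h := phi_norm x
  refine ⟨?_, ?_, ?_⟩ <;> (intro h0; rw [h0] at h; simp at h; exact hx h)

lemma norm_isUnit {x : Cub ℤ} (hx : IsUnit x) : norm x = 1 ∨ norm x = -1 :=
  Int.isUnit_iff.1 (hx.map norm)

lemma TotPos.mul_sq {x y : Cub ℤ} (hx : TotPos x) (hy : IsUnit y) : TotPos (x * y ^ 2) := by
  have hN : norm y ≠ 0 := by rcases norm_isUnit hy with h | h <;> simp [h]
  obtain ⟨h1, h2, h3⟩ := phi_ne_zero hN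
  obtain ⟨g1, g2, g3⟩ := hx
  refine ⟨?_, ?_, ?_⟩ <;> simp only [map_mul, map_pow] <;> positivity

lemma TotPos.a_pos {x : Cub ℤ} (hx : TotPos x) : 0 < x.a := by
  have : phi x + phi (conj x) + phi (conj (conj x)) = 3 * x.a := by
    simp only [phi_apply, conj_a, conj_b, conj_c]
    push_cast
    ring
  have h : (0 : ℝ) < x.a := by linarith [hx.1, hx.2.1, hx.2.2]
  exact_mod_cast h

lemma TotPos.norm_pos {x : Cub ℤ} (hx : TotPos x) : 0 < norm x := by
  have := phi_norm x
  have h : (0 : ℝ) < (norm x : ℤ) := by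
    rw [this]; exact mul_pos (mul_pos hx.1 hx.2.1) hx.2.2
  exact_mod_cast h

lemma isUnit_v : IsUnit (v : Cub ℤ) :=
  IsUnit.of_mul_eq_one (-1 - w) (by ext <;> simp)

lemma isUnit_one_add_v : IsUnit (1 + v : Cub ℤ) :=
  IsUnit.of_mul_eq_one (v + w) (by ext <;> simp)

lemma TotPos.exists_sq {u : Cub ℤ} (hu : IsUnit u) (hpos : TotPos u) : ∃ x, u = x ^ 2 := by
  induction hn : u.a.toNat using Nat.strong_induction_on generalizing u with | _ n ih
  have step : ∀ y z : Cub ℤ, y * z = 1 → (u * y ^ 2).a < u.a → ∃ x, u = x ^ 2 := by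
    intro y z hyz hlt
    have hy : IsUnit y := IsUnit.of_mul_eq_one z hyz
    obtain ⟨x, hx⟩ := ih (u * y ^ 2).a.toNat (by have := hpos.a_pos; omega)
      (hu.mul (hy.pow 2)) (hpos.mul_sq hy) rfl
    refine ⟨x * z, ?_⟩
    rw [mul_pow, ← hx, mul_assoc, ← mul_pow, hyz, one_pow, mul_one]
  by_contra hne
  have l1 := fun h => hne (step v (-1 - w) (by ext <;> simp) h)
  have l2 := fun h => hne (step w (-1 + v + w) (by ext <;> simp) h)
  have l3 := fun h => hne (step (-v - w) (-1 - v) (by ext <;> simp) h)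
  have m1 := fun h => hne (step (-1 - w) v (by ext <;> simp) h)
  have m2 := fun h => hne (step (-1 + v + w) w (by ext <;> simp) h)
  have m3 := fun h => hne (step (-1 - v) (-v - w) (by ext <;> simp) h)
  simp [pow_two] at l1 l2 l3 m1 m2 m3
  have hN : norm u = 1 := by
    have := hpos.norm_pos
    rcases norm_isUnit hu with h | h <;> omega
  rw [norm_eq] at hN
  have ha := hpos.a_pos
  obtain ⟨a, b, c⟩ := u
  simp only at *
  have L1 : 0 ≤ a + (b - 2 * c) := by linarith
  have L2 : 0 ≤ a + (b + c) := by linarith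
  have L3 : 0 ≤ a + (-2 * b + c) := by linarith
  have M1 : 0 ≤ 2 * a + (b + c) - 2 * (b - 2 * c) := by linarith
  have M2 : 0 ≤ 2 * a + (-2 * b + c) - 2 * (b + c) := by linarith
  have M3 : 0 ≤ 2 * a + (b - 2 * c) - 2 * (-2 * b + c) := by linarith
  have key : a ^ 3 ≤ 3 := by
    nlinarith [mul_nonneg (mul_nonneg L1 L2) L3, mul_nonneg (mul_nonneg M1 M2) M3,
      mul_nonneg (mul_nonneg L1 L2) M1, mul_nonneg (mul_nonneg L2 L3) M2,
      mul_nonneg (mul_nonneg L3 L1) M3]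
  have ha1 : a = 1 := by
    by_contra h
    have : 2 ≤ a := by omega
    have : 2 ^ 3 ≤ a ^ 3 := by gcongr
    omega
  subst ha1
  have hb1 : -2 ≤ b := by omega
  have hb2 : b ≤ 2 := by omega
  have hc1 : -2 ≤ c := by omega
  have hc2 : c ≤ 2 := by omega
  have : b = 0 ∧ c = 0 := by
    clear hne step m1 m2 m3 l1 l2 l3 ih hu hpos
    interval_cases b <;> interval_cases c <;> simp_all
  obtain ⟨rfl, rfl⟩ := this
  exact hne ⟨1, by ext <;> simp⟩

set_option linter.unusedSimpArgs false in
/-- Every unit is, up to squares, one of eight explicit units. -/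
lemma exists_unit_repr {u : Cub ℤ} (hu : IsUnit u) :
    ∃ (e i j : Fin 2) (x : Cub ℤ),
      u = (-1) ^ (e : ℕ) * v ^ (i : ℕ) * (1 + v) ^ (j : ℕ) * x ^ 2 := by
  have main : ∀ e i j : Fin 2,
      TotPos (u * ((-1) ^ (e : ℕ) * v ^ (i : ℕ) * (1 + v) ^ (j : ℕ))) →
      ∃ (e i j : Fin 2) (x : Cub ℤ),
        u = (-1) ^ (e : ℕ) * v ^ (i : ℕ) * (1 + v) ^ (j : ℕ) * x ^ 2 := by
    intro e i j h
    have ht : IsUnit ((-1) ^ (e : ℕ) * v ^ (i : ℕ) * (1 + v) ^ (j : ℕ) : Cub ℤ) :=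
      ((isUnit_one.neg.pow _).mul (isUnit_v.pow _)).mul (isUnit_one_add_v.pow _)
    obtain ⟨x, hx⟩ := h.exists_sq (hu.mul ht)
    obtain ⟨s, hs⟩ := ht.exists_right_inv
    refine ⟨e, i, j, x * s, ?_⟩
    generalize ((-1) ^ (e : ℕ) * v ^ (i : ℕ) * (1 + v) ^ (j : ℕ) : Cub ℤ) = t at *
    linear_combination (t * s ^ 2) * hx + (-u * t * s - u) * hs
  have hN : norm u ≠ 0 := by rcases norm_isUnit hu with h | h <;> simp [h]
  obtain ⟨h1, h2, h3⟩ := phi_ne_zero hN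
  have b1 := lt_theta
  have b2 := theta_lt
  obtain ⟨b3, b4⟩ := theta_sq_bounds
  have v1 : 0 < phi v := by rw [phi_v]; linarith
  have v2 : phi (conj v) < 0 := by simp [phi_apply]; linarith
  have v3 : phi (conj (conj v)) < 0 := by simp [phi_apply]; linarith
  have w1 : 0 < phi (1 + v) := by rw [map_add, phi_v, map_one]; linarith
  have w2 : phi (conj (1 + v)) < 0 := by simp [phi_apply]; linarith
  have w3 : 0 < phi (conj (conj (1 + v))) := by simp [phi_apply]; linarith
  rcases lt_or_gt_of_ne h1 with h1 | h1 <;> rcases lt_or_gt_of_ne h2 with h2 | h2 <;>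
    rcases lt_or_gt_of_ne h3 with h3 | h3
  · exact main 1 0 0 (by
      simp only [TotPos, map_mul, map_pow, map_neg, map_one, Fin.val_zero, Fin.val_one, pow_zero,
        pow_one, mul_one, one_mul]
      simp [mul_pos_iff, mul_neg_iff, h1, h2, h3, v1, v2, v3, w1, w2, w3, -map_add])
  · exact main 1 1 1 (by
      simp only [TotPos, map_mul, map_pow, map_neg, map_one, Fin.val_zero, Fin.val_one, pow_zero,
        pow_one, mul_one, one_mul]
      simp [mul_pos_iff, mul_neg_iff, h1, h2, h3, v1, v2, v3, w1, w2, w3, -map_add])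
  · exact main 1 0 1 (by
      simp only [TotPos, map_mul, map_pow, map_neg, map_one, Fin.val_zero, Fin.val_one, pow_zero,
        pow_one, mul_one, one_mul]
      simp [mul_pos_iff, mul_neg_iff, h1, h2, h3, v1, v2, v3, w1, w2, w3, -map_add])
  · exact main 1 1 0 (by
      simp only [TotPos, map_mul, map_pow, map_neg, map_one, Fin.val_zero, Fin.val_one, pow_zero,
        pow_one, mul_one, one_mul]
      simp [mul_pos_iff, mul_neg_iff, h1, h2, h3, v1, v2, v3, w1, w2, w3, -map_add])
  · exact main 0 1 0 (by
      simp only [TotPos, map_mul, map_pow, map_neg, map_one, Fin.val_zero, Fin.val_one, pow_zero,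
        pow_one, mul_one, one_mul]
      simp [mul_pos_iff, mul_neg_iff, h1, h2, h3, v1, v2, v3, w1, w2, w3, -map_add])
  · exact main 0 0 1 (by
      simp only [TotPos, map_mul, map_pow, map_neg, map_one, Fin.val_zero, Fin.val_one, pow_zero,
        pow_one, mul_one, one_mul]
      simp [mul_pos_iff, mul_neg_iff, h1, h2, h3, v1, v2, v3, w1, w2, w3, -map_add])
  · exact main 0 1 1 (by
      simp only [TotPos, map_mul, map_pow, map_neg, map_one, Fin.val_zero, Fin.val_one, pow_zero,
        pow_one, mul_one, one_mul]
      simp [mul_pos_iff, mul_neg_iff, h1, h2, h3, v1, v2, v3, w1, w2, w3, -map_add])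
  · exact main 0 0 0 (by
      simp only [TotPos, map_mul, map_pow, map_neg, map_one, Fin.val_zero, Fin.val_one, pow_zero,
        pow_one, mul_one, one_mul]
      simp [mul_pos_iff, mul_neg_iff, h1, h2, h3, v1, v2, v3, w1, w2, w3, -map_add])

lemma isUnit_of_norm {x : Cub ℤ} (h : IsUnit (norm x)) : IsUnit x := by
  have h1 := h.map (Int.castRingHom (Cub ℤ))
  rw [eq_intCast, coe_norm, mul_assoc] at h1
  exact isUnit_of_mul_isUnit_left h1

lemma prime_of_norm {x : Cub ℤ} (h : Prime (norm x)) : Prime x := by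
  refine Irreducible.prime ⟨fun hx => h.not_isUnit (hx.map norm), fun y z hyz => ?_⟩
  have := h.irreducible.isUnit_or_isUnit (a := norm y) (b := norm z) (by rw [hyz, map_mul])
  exact this.imp isUnit_of_norm isUnit_of_norm

lemma prime_two : Prime (2 : Cub ℤ) := by
  have h2 : norm (2 : Cub ℤ) = 8 := by simp [norm_eq]
  refine ⟨fun h => by rw [h] at h2; simp [norm_eq] at h2, fun h => ?_, fun x y h => ?_⟩
  · rcases norm_isUnit h with h | h <;> omega
  · rw [two_dvd_iff_norm] at *
    rw [two_dvd_iff_norm]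
    rw [map_mul] at h
    exact Int.prime_two.dvd_or_dvd h

/-- A generator of the prime above `3`. -/
def pi {A : Type*} [CommRing A] : Cub A := 1 + 2 * v

lemma prime_pi : Prime (pi : Cub ℤ) := by
  apply prime_of_norm
  have : norm (pi : Cub ℤ) = -3 := by simp [norm_eq, pi]
  rw [this]
  exact Int.prime_three.neg

/-- Representatives of the classes, modulo squares, of products of units and powers of `pi`. -/
def rep (A : Type*) [CommRing A] (e i j k : Fin 2) : Cub A :=
  (-1) ^ (e : ℕ) * v ^ (i : ℕ) * (1 + v) ^ (j : ℕ) * pi ^ (k : ℕ)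

lemma exists_unit_mul_pi_pow_mul_sq {a b y : Cub ℤ} (ha : a ≠ 0) (hab : a * b = y ^ 2)
    (h : ∀ p, Prime p → p ∣ a → p ∣ b → Associated pi p) :
    ∃ u i r, IsUnit u ∧ a = u * pi ^ i * r ^ 2 := by
  induction a using (IsWellFounded.wf (r := DvdNotUnit (α := Cub ℤ))).induction generalizing b y with
  | _ a ih
  by_cases hu : IsUnit a
  · exact ⟨a, 0, 1, hu, by simp⟩
  obtain ⟨p, hp, a', rfl⟩ := WfDvdMonoid.exists_irreducible_factor hu ha
  have hp' := hp.prime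
  have ha' : a' ≠ 0 := right_ne_zero_of_mul ha
  by_cases hpb : p ∣ b
  · obtain ⟨ε, hε⟩ := h p hp' (dvd_mul_right _ _) hpb
    obtain ⟨u, i, r, hu, hr⟩ := ih a' ⟨ha', p, hp.not_isUnit, mul_comm _ _⟩ ha'
      (show a' * (p * b) = y ^ 2 by rw [← hab]; ring) (by
        intro q hq h1 h2
        rcases hq.dvd_or_dvd h2 with h3 | h3
        · exact (h p hp' (dvd_mul_right _ _) hpb).trans
            ((hq.irreducible.associated_of_dvd hp h3).symm)
        · exact h q hq (h1.mul_left _) h3)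
    exact ⟨ε * u, i + 1, r, ε.isUnit.mul hu, by rw [hr, ← hε]; ring⟩
  · obtain ⟨y', rfl⟩ := hp'.dvd_of_dvd_pow (show p ∣ y ^ 2 from ⟨a' * b, by rw [← hab]; ring⟩)
    have h1 : a' * b = p * y' ^ 2 := mul_left_cancel₀ hp.ne_zero (by linear_combination hab)
    obtain ⟨c, rfl⟩ := (hp'.dvd_or_dvd ⟨_, h1⟩).resolve_right hpb
    obtain ⟨u, i, r, hu, hr⟩ := ih c ⟨right_ne_zero_of_mul ha', p * p,
      fun hh => hp.not_isUnit (isUnit_of_mul_isUnit_left hh), by ring⟩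
      (right_ne_zero_of_mul ha')
      (show c * b = y' ^ 2 from mul_left_cancel₀ hp.ne_zero (by linear_combination h1))
      (fun q hq h1 h2 => h q hq ((h1.mul_left _).mul_left _) h2)
    exact ⟨u, i, p * r, hu, by rw [hr]; ring⟩

lemma exists_rep {a b y : Cub ℤ} (ha : a ≠ 0) (hab : a * b = y ^ 2)
    (h : ∀ p, Prime p → p ∣ a → p ∣ b → Associated pi p) :
    ∃ e i j k r, a = rep ℤ e i j k * r ^ 2 := by
  obtain ⟨u, n, r, hu, rfl⟩ := exists_unit_mul_pi_pow_mul_sq ha hab h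
  obtain ⟨e, i, j, x, rfl⟩ := exists_unit_repr hu
  refine ⟨e, i, j, ⟨n % 2, Nat.mod_lt _ two_pos⟩, x * r * pi ^ (n / 2), ?_⟩
  have : (pi : Cub ℤ) ^ n = pi ^ (n % 2) * (pi ^ (n / 2)) ^ 2 := by
    rw [← pow_mul, ← pow_add]; congr 1; omega
  rw [this, rep]
  ring

lemma map_rep {A B : Type*} [CommRing A] [CommRing B] (f : A →+* B) (e i j k : Fin 2) :
    map f (rep A e i j k) = rep B e i j k := by
  have hv : map f v = v := by ext <;> simp [map]
  have h2 : map f 2 = 2 := map_ofNat (map f) 2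
  simp [rep, pi, hv, h2]

lemma rep_eq_sq_mod_eight : ∀ a b c : ZMod 8, ∀ e i j k,
    rep (ZMod 8) e i j k = ⟨a, b, c⟩ ^ 2 → e = 0 ∧ i = 0 ∧ j = 0 ∧ k = 0 := by
  decide +kernel

lemma rep_eq_five_mul_sq_mod_eight : ∀ a b c : ZMod 8, ∀ e i j k,
    rep (ZMod 8) e i j k = 5 * ⟨a, b, c⟩ ^ 2 → e = 1 ∧ i = 0 ∧ j = 1 ∧ k = 1 := by
  decide +kernel

lemma associated_pi {p : Cub ℤ} (hp : Prime p) (h : p ∣ 3) : Associated pi p := by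
  have h3 : (3 : Cub ℤ) = pi ^ 3 * ⟨35, 14, 40⟩ := by ext <;> simp [pi, pow_succ]
  have hu : IsUnit (⟨35, 14, 40⟩ : Cub ℤ) := isUnit_of_norm (by simp [norm_eq])
  have h1 : p ∣ pi := hp.dvd_of_dvd_pow (hu.dvd_mul_right.1 (h3 ▸ h))
  exact (hp.irreducible.associated_of_dvd prime_pi.irreducible h1).symm

/-- First root of the `2`-division cubic of the elliptic curve. -/
def e₁ : Cub ℤ := ⟨3, 2, -2⟩
/-- Second root of the `2`-division cubic of the elliptic curve. -/
def e₂ : Cub ℤ := ⟨2, 0, 4⟩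
/-- Third root of the `2`-division cubic of the elliptic curve. -/
def e₃ : Cub ℤ := ⟨2, 4, 0⟩

lemma e₁_sub_e₂_dvd : e₁ - e₂ ∣ 3 := ⟨⟨51, -58, -38⟩, by ext <;> simp [e₁, e₂]⟩
lemma e₁_sub_e₃_dvd : e₁ - e₃ ∣ 3 := ⟨⟨3, 2, -2⟩, by ext <;> simp [e₁, e₃]⟩
lemma e₂_sub_e₃_dvd : e₂ - e₃ ∣ 2 ^ 2 * 3 :=
  ⟨⟨1, -1, 0⟩, by ext <;> simp [e₂, e₃, pow_two]⟩

/-- The homogenized cubic `(n - e₁ D) (n - e₂ D) (n - e₃ D)`. -/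
def cubic (n D : Cub ℤ) : Cub ℤ := (n - e₁ * D) * (n - e₂ * D) * (n - e₃ * D)

lemma isCoprime_sub_mul {n D : Cub ℤ} (h : IsCoprime n D) (e : Cub ℤ) :
    IsCoprime D (n - e * D) := by
  obtain ⟨A, B, hAB⟩ := h
  exact ⟨B + A * e, A, by linear_combination hAB⟩

lemma exists_coprime_solution {k : ℕ} {n σ y : Cub ℤ} (hσ : ¬ 2 ∣ σ) (hn : 2 ∣ n - σ ^ 2)
    (h : cubic n ((2 ^ k * σ) ^ 2) = y ^ 2) :
    ∃ n' σ' y', ¬ 2 ∣ σ' ∧ 2 ∣ n' - σ' ^ 2 ∧ cubic n' ((2 ^ k * σ') ^ 2) = y' ^ 2 ∧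
      IsCoprime n' (2 ^ k * σ') := by
  classical
  have hn2 : ¬ 2 ∣ n := fun h2 => hσ (prime_two.dvd_of_dvd_pow ((dvd_sub_right h2).1 hn))
  have hn0 : n ≠ 0 := by rintro rfl; simp at hn2
  have hσ0 : σ ≠ 0 := by rintro rfl; simp at hσ
  have h20 : (2 : Cub ℤ) ≠ 0 := prime_two.ne_zero
  obtain ⟨n', hn'⟩ := EuclideanDomain.gcd_dvd_left n ((2 ^ k * σ) ^ 2)
  obtain ⟨D, hD⟩ := EuclideanDomain.gcd_dvd_right n ((2 ^ k * σ) ^ 2)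
  have hb := EuclideanDomain.gcd_eq_gcd_ab n ((2 ^ k * σ) ^ 2)
  generalize EuclideanDomain.gcdA n ((2 ^ k * σ) ^ 2) = A at hb
  generalize EuclideanDomain.gcdB n ((2 ^ k * σ) ^ 2) = B at hb
  generalize EuclideanDomain.gcd n ((2 ^ k * σ) ^ 2) = g at *
  have hg0 : g ≠ 0 := by rintro rfl; simp at hn'; exact hn0 hn'
  have hcop : IsCoprime n' D :=
    ⟨A, B, mul_left_cancel₀ hg0 (by linear_combination -hb - A * hn' - B * hD)⟩
  have hg2 : ¬ 2 ∣ g := fun h2 => hn2 (hn' ▸ h2.mul_right _)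
  have hD0 : D ≠ 0 := by
    rintro rfl
    have : (2 ^ k * σ) ^ 2 ≠ 0 := by positivity
    rw [mul_zero] at hD; exact this hD
  have hq : (g ^ 2) ^ 2 * (D * cubic n' D) = (y * (2 ^ k * σ)) ^ 2 := by
    rw [mul_pow, ← h, hD]
    simp only [cubic, hn']; ring
  obtain ⟨z, hz⟩ := (UniqueFactorizationMonoid.pow_dvd_pow_iff_dvd two_ne_zero).1 ⟨_, hq.symm⟩
  have hz2 : D * cubic n' D = z ^ 2 :=
    mul_left_cancel₀ (pow_ne_zero 2 (pow_ne_zero 2 hg0)) (by rw [hq, hz]; ring)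
  have hcub : IsCoprime D (cubic n' D) :=
    ((isCoprime_sub_mul hcop _).mul_right (isCoprime_sub_mul hcop _)).mul_right
      (isCoprime_sub_mul hcop _)
  obtain ⟨d, u, hd⟩ := exists_associated_pow_of_mul_eq_pow' hcub hz2
  obtain ⟨ui, hui⟩ := u.isUnit.exists_right_inv
  have hu2 : ¬ 2 ∣ (u : Cub ℤ) := fun h2 => prime_two.not_isUnit (isUnit_of_dvd_unit h2 u.isUnit)
  generalize (u : Cub ℤ) = u at *
  have hu0 : u ≠ 0 := by rintro rfl; simp at hui
  have hd0 : d ≠ 0 := by rintro rfl; simp at hd; exact hD0 hd.symm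
  obtain ⟨m, hm⟩ : ∃ m, n' = u * m := ⟨ui * n', by linear_combination (-n') * hui⟩
  subst hm
  have hP : (u ^ 2 * d) ^ 2 * cubic m (d ^ 2) = z ^ 2 := by
    rw [← hz2, ← hd]; simp only [cubic]; ring
  obtain ⟨y', hy'⟩ := (UniqueFactorizationMonoid.pow_dvd_pow_iff_dvd two_ne_zero).1 ⟨_, hP.symm⟩
  have hy2 : cubic m (d ^ 2) = y' ^ 2 :=
    mul_left_cancel₀ (pow_ne_zero 2 (mul_ne_zero (pow_ne_zero 2 hu0) hd0)) (by rw [hP, hy']; ring)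
  have hgu2 : ¬ 2 ∣ g * u := fun h2 => (prime_two.dvd_or_dvd h2).elim hg2 hu2
  have hgud : g * u * d ^ 2 = (2 ^ k * σ) ^ 2 := by rw [hD, ← hd]; ring
  have h2d : (2 : Cub ℤ) ^ (k * 2) ∣ d ^ 2 :=
    prime_two.pow_dvd_of_dvd_mul_left _ hgu2 (by rw [hgud, mul_pow, pow_mul]; exact dvd_mul_right _ _)
  rw [pow_mul, UniqueFactorizationMonoid.pow_dvd_pow_iff_dvd two_ne_zero] at h2d
  obtain ⟨τ, rfl⟩ := h2d
  have hτ : g * u * τ ^ 2 = σ ^ 2 :=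
    mul_left_cancel₀ (pow_ne_zero 2 (pow_ne_zero k h20)) (by linear_combination hgud)
  refine ⟨m, τ, y', fun h2 => hσ (prime_two.dvd_of_dvd_pow (n := 2) ?_), ?_, hy2, ?_⟩
  · rw [← hτ]; exact (h2.pow two_ne_zero).mul_left _
  · refine (prime_two.dvd_or_dvd (a := g * u) ?_).resolve_left hgu2
    convert hn using 1
    rw [mul_sub, hτ, hn']; ring
  · obtain ⟨A, B, hAB⟩ := hcop
    exact ⟨A * u, B * u * (2 ^ k * τ), by rw [← hd] at hAB; linear_combination hAB⟩

lemma dvd_sub_of_dvd {n s e e' p : Cub ℤ} (hp : Prime p) (hc : IsCoprime n s)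
    (h1 : p ∣ n - e * s ^ 2) (h2 : p ∣ n - e' * s ^ 2) : p ∣ e - e' := by
  have h3 : p ∣ (e - e') * s ^ 2 := by
    have := dvd_sub h2 h1
    convert this using 1; ring
  refine (hp.dvd_or_dvd h3).resolve_right fun h => ?_
  have hs := hp.dvd_of_dvd_pow h
  have hn : p ∣ n := (dvd_sub_left ((h.mul_left e))).1 h1
  exact hp.not_isUnit (hc.isUnit_of_dvd' hn hs)

lemma exists_dvd_sub_mul_sq {t r n c : Cub ℤ} (hn : ¬ 2 ∣ n) (hc : ¬ 2 ∣ c)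
    (h : 8 ∣ t * r ^ 2 - c * n ^ 2) : ∃ z, 8 ∣ t - c * z ^ 2 := by
  have hr : ¬ 2 ∣ r := by
    intro h2
    have h3 : (2 : Cub ℤ) ∣ t * r ^ 2 - c * n ^ 2 := Dvd.dvd.trans ⟨4, by norm_num⟩ h
    rw [dvd_sub_right ((h2.pow two_ne_zero).mul_left _)] at h3
    rcases prime_two.dvd_or_dvd h3 with h4 | h4
    · exact hc h4
    · exact hn (prime_two.dvd_of_dvd_pow h4)
  refine ⟨n * (conj r * conj (conj r)), ?_⟩
  have h1 := coe_norm r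
  rw [two_dvd_iff_norm] at hr
  have h8 : (8 : ℤ) ∣ norm r ^ 2 - 1 := Int.eight_dvd_sq_sub_one_of_odd (by
    rw [← Int.not_even_iff_odd, even_iff_two_dvd]; exact hr)
  obtain ⟨q, hq⟩ := h8
  obtain ⟨x, hx⟩ := h
  have hq' : ((norm r : ℤ) : Cub ℤ) ^ 2 - 1 = 8 * (q : Cub ℤ) := by
    have := congrArg (Int.cast : ℤ → Cub ℤ) hq
    push_cast at this
    exact this
  refine ⟨x * (conj r * conj (conj r)) ^ 2 - t * q, ?_⟩
  rw [h1] at hq'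
  linear_combination (conj r * conj (conj r)) ^ 2 * hx - t * hq'

lemma map_eq_of_dvd {x y : Cub ℤ} (h : 8 ∣ x - y) :
    map (Int.castRingHom (ZMod 8)) x = map (Int.castRingHom (ZMod 8)) y := by
  obtain ⟨z, hz⟩ := h
  rw [← sub_eq_zero, ← map_sub, hz, map_mul, map_ofNat]
  have : (OfNat.ofNat 8 : Cub (ZMod 8)) = 0 := by decide
  rw [this, zero_mul]

lemma rep_eq_zero_of_sq {e i j k : Fin 2} {r n : Cub ℤ} (hn : ¬ 2 ∣ n)
    (h : 8 ∣ rep ℤ e i j k * r ^ 2 - n ^ 2) : rep ℤ e i j k = 1 := by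
  obtain ⟨z, hz⟩ := exists_dvd_sub_mul_sq (t := rep ℤ e i j k) (r := r) (c := 1) hn
    (fun h => prime_two.not_isUnit (isUnit_of_dvd_one h)) (by rwa [one_mul])
  have := map_eq_of_dvd hz
  rw [map_rep, one_mul, map_pow] at this
  obtain ⟨rfl, rfl, rfl, rfl⟩ := rep_eq_sq_mod_eight _ _ _ e i j k this
  simp [rep]

lemma rep_eq_of_five_mul_sq {e i j k : Fin 2} {r n : Cub ℤ} (hn : ¬ 2 ∣ n)
    (h : 8 ∣ rep ℤ e i j k * r ^ 2 - 5 * n ^ 2) : rep ℤ e i j k = -((1 + v) * pi) := by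
  obtain ⟨z, hz⟩ := exists_dvd_sub_mul_sq (c := 5) hn
    (fun h => by rw [two_dvd_iff] at h; simp at h) h
  have := map_eq_of_dvd hz
  rw [map_rep, map_mul, map_pow, map_ofNat] at this
  obtain ⟨rfl, rfl, rfl, rfl⟩ := rep_eq_five_mul_sq_mod_eight _ _ _ e i j k this
  simp [rep]
  ring

lemma not_two_dvd_sub {n s : Cub ℤ} (hn : ¬ 2 ∣ n) (hs : 2 ∣ s) (e : Cub ℤ) :
    ¬ 2 ∣ n - e * s ^ 2 := fun h =>
  hn ((dvd_sub_left ((hs.pow two_ne_zero).mul_left e)).1 h)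

lemma associated_pi_of_dvd {n s p : Cub ℤ} (hn : ¬ 2 ∣ n) (hs : 2 ∣ s) (hc : IsCoprime n s)
    (hp : Prime p) {e e' : Cub ℤ} (he : e - e' ∣ 2 ^ 2 * 3) (h1 : p ∣ n - e * s ^ 2)
    (h2 : p ∣ n - e' * s ^ 2) : Associated pi p := by
  have h := (dvd_sub_of_dvd hp hc h1 h2).trans he
  refine associated_pi hp ((hp.dvd_or_dvd h).resolve_left fun h3 => ?_)
  have h4 := hp.dvd_of_dvd_pow h3
  exact not_two_dvd_sub hn hs e
    ((hp.irreducible.associated_of_dvd prime_two.irreducible h4).symm.dvd.trans h1)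

lemma exists_rep_of_mul {n s y a b c : Cub ℤ} (hn : ¬ 2 ∣ n) (hs : 2 ∣ s) (hc : IsCoprime n s)
    (hac : a - c ∣ 2 ^ 2 * 3) (hbc : b - c ∣ 2 ^ 2 * 3)
    (h : (n - a * s ^ 2) * (n - b * s ^ 2) * (n - c * s ^ 2) = y ^ 2) :
    ∃ e i j k r, (n - a * s ^ 2) * (n - b * s ^ 2) = rep ℤ e i j k * r ^ 2 := by
  refine exists_rep (fun h0 => ?_) h fun p hp h1 h2 => ?_
  · have : 2 ∣ (n - a * s ^ 2) * (n - b * s ^ 2) := by simp [h0]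
    exact (prime_two.dvd_or_dvd this).elim (not_two_dvd_sub hn hs a) (not_two_dvd_sub hn hs b)
  · rcases hp.dvd_or_dvd h1 with h3 | h3
    · exact associated_pi_of_dvd hn hs hc hp hac h3 h2
    · exact associated_pi_of_dvd hn hs hc hp hbc h3 h2

lemma e₁₂ : e₁ - e₂ ∣ 2 ^ 2 * 3 := e₁_sub_e₂_dvd.mul_left _
lemma e₁₃ : e₁ - e₃ ∣ 2 ^ 2 * 3 := e₁_sub_e₃_dvd.mul_left _
lemma e₂₁ : e₂ - e₁ ∣ 2 ^ 2 * 3 := by rw [← neg_sub, neg_dvd]; exact e₁₂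
lemma e₃₁ : e₃ - e₁ ∣ 2 ^ 2 * 3 := by rw [← neg_sub, neg_dvd]; exact e₁₃
lemma e₃₂ : e₃ - e₂ ∣ 2 ^ 2 * 3 := by rw [← neg_sub, neg_dvd]; exact e₂_sub_e₃_dvd

lemma no_solution_level_one {n σ y : Cub ℤ} (hσ : ¬ 2 ∣ σ) (hn : 2 ∣ n - σ ^ 2)
    (h : cubic n ((2 * σ) ^ 2) = y ^ 2) (hc : IsCoprime n (2 * σ)) : False := by
  have hn2 : ¬ 2 ∣ n := fun h2 => hσ (prime_two.dvd_of_dvd_pow ((dvd_sub_right h2).1 hn))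
  have hs : 2 ∣ 2 * σ := dvd_mul_right _ _
  obtain ⟨e, i, j, k, r, hr⟩ := exists_rep_of_mul (a := e₁) (b := e₃) (c := e₂) hn2 hs hc e₁₂
    e₃₂ (y := y) (by rw [← h, cubic]; ring)
  have h8 : 8 ∣ rep ℤ e i j k * r ^ 2 - 5 * n ^ 2 := by
    rw [← hr]
    obtain ⟨x, hx⟩ := hn
    have he : e₁ + e₃ = 1 + 2 * ⟨2, 3, -1⟩ := by ext <;> simp [e₁, e₃]
    generalize (⟨2, 3, -1⟩ : Cub ℤ) = ε at he
    exact ⟨-n ^ 2 + n * x - ε * n * σ ^ 2 + 2 * e₁ * e₃ * σ ^ 4, by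
      linear_combination 4 * n * hx - 4 * n * σ ^ 2 * he⟩
  have ht := rep_eq_of_five_mul_sq hn2 h8
  have p13 := congrArg phi (ht ▸ hr)
  have p := congrArg phi h
  rw [cubic] at p
  simp only [map_mul, map_sub, map_pow, map_neg, map_add, map_one, pi, phi_v] at p13 p
  have q1 : phi e₁ = -1 + 2 * theta + 2 * theta ^ 2 := by simp [phi_apply, e₁]; ring
  have q2 : phi e₂ = 10 - 4 * theta ^ 2 := by simp [phi_apply, e₂]; ring
  have q3 : phi e₃ = 2 + 4 * theta := by simp [phi_apply, e₃]
  have two : phi 2 = 2 := map_ofNat phi 2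
  have hr0 : phi r ≠ 0 := by
    refine (phi_ne_zero fun h0 => ?_).1
    have : 2 ∣ (n - e₁ * (2 * σ) ^ 2) * (n - e₃ * (2 * σ) ^ 2) := by
      rw [hr, norm_eq_zero h0]; simp
    exact (prime_two.dvd_or_dvd this).elim (not_two_dvd_sub hn2 hs _) (not_two_dvd_sub hn2 hs _)
  rw [two] at p p13
  obtain ⟨b3, b4⟩ := theta_sq_bounds
  have b1 := lt_theta
  have b2 := theta_lt
  have l1 : phi e₂ ≤ phi e₁ := by rw [q1, q2]; linarith
  have l2 : phi e₂ ≤ phi e₃ := by rw [q3, q2]; linarith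
  have hS : 0 ≤ (2 * phi σ) ^ 2 := by positivity
  generalize (2 * phi σ) ^ 2 = S at *
  have m1 := mul_le_mul_of_nonneg_right l1 hS
  have m2 := mul_le_mul_of_nonneg_right l2 hS
  have hneg : (phi n - phi e₁ * S) * (phi n - phi e₃ * S) < 0 := by
    rw [p13]
    have : 0 < phi r ^ 2 := by positivity
    have : 0 < (1 + theta) * (1 + 2 * theta) := by nlinarith
    nlinarith
  have hA2 : phi n - phi e₂ * S ≤ 0 := by
    by_contra! hA
    nlinarith [mul_neg_of_neg_of_pos hneg hA, sq_nonneg (phi y)]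
  nlinarith [mul_nonneg_of_nonpos_of_nonpos (show phi n - phi e₁ * S ≤ 0 by linarith)
    (show phi n - phi e₃ * S ≤ 0 by linarith)]

lemma exists_eq_sq {a b c y r : Cub ℤ} (hbc : b * c = r ^ 2) (hr : r ≠ 0)
    (h : a * b * c = y ^ 2) : ∃ x, a = x ^ 2 := by
  have h1 : r ^ 2 * a = y ^ 2 := by rw [← hbc, ← h]; ring
  obtain ⟨x, rfl⟩ := (UniqueFactorizationMonoid.pow_dvd_pow_iff_dvd two_ne_zero).1 ⟨_, h1.symm⟩
  exact ⟨x, mul_left_cancel₀ (pow_ne_zero 2 hr) (by rw [h1]; ring)⟩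

lemma exists_sign {m : ℕ} {x y : Cub ℤ} (hy : ¬ 2 ∣ y) (h : 2 ^ (m + 2) ∣ x ^ 2 - y ^ 2) :
    2 ^ (m + 1) ∣ x - y ∨ 2 ^ (m + 1) ∣ x + y := by
  have h20 : (2 : Cub ℤ) ≠ 0 := prime_two.ne_zero
  have h2 : 2 ∣ x - y := by
    have h3 : 2 ∣ (x - y) * (x + y) := by
      have : (2 : Cub ℤ) ∣ 2 ^ (m + 2) := dvd_pow_self _ (by omega)
      convert this.trans h using 1; ring
    rcases prime_two.dvd_or_dvd h3 with h4 | h4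
    · exact h4
    · have : x - y = x + y - 2 * y := by ring
      rw [this]; exact dvd_sub h4 (dvd_mul_right _ _)
  obtain ⟨d, hd⟩ := h2
  obtain rfl : x = y + 2 * d := by linear_combination hd
  have h5 : (2 : Cub ℤ) ^ m ∣ d * (d + y) := by
    obtain ⟨z, hz⟩ := h
    exact ⟨z, mul_left_cancel₀ (pow_ne_zero 2 h20) (by linear_combination hz)⟩
  by_cases hd2 : 2 ∣ d
  · left
    have h6 : ¬ 2 ∣ d + y := fun h => hy ((dvd_add_right hd2).1 h)
    obtain ⟨z, hz⟩ := prime_two.pow_dvd_of_dvd_mul_right m h6 h5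
    exact ⟨z, by rw [hz]; ring⟩
  · right
    obtain ⟨z, hz⟩ := prime_two.pow_dvd_of_dvd_mul_left m hd2 h5
    exact ⟨z, by linear_combination 2 * hz⟩

lemma mul_eq_sq_of_level {n s y a b c : Cub ℤ} (hn : ¬ 2 ∣ n) (hs : 4 ∣ s) (hc : IsCoprime n s)
    (hac : a - c ∣ 2 ^ 2 * 3) (hbc : b - c ∣ 2 ^ 2 * 3)
    (h : (n - a * s ^ 2) * (n - b * s ^ 2) * (n - c * s ^ 2) = y ^ 2) :
    ∃ r, r ≠ 0 ∧ (n - a * s ^ 2) * (n - b * s ^ 2) = r ^ 2 := by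
  have hs2 : 2 ∣ s := Dvd.dvd.trans ⟨2, by norm_num⟩ hs
  obtain ⟨e, i, j, k, r, hr⟩ := exists_rep_of_mul hn hs2 hc hac hbc h
  have h8 : 8 ∣ rep ℤ e i j k * r ^ 2 - n ^ 2 := by
    rw [← hr]
    obtain ⟨z, rfl⟩ := hs
    exact ⟨-2 * (a + b) * n * z ^ 2 + 32 * a * b * z ^ 4, by ring⟩
  rw [rep_eq_zero_of_sq hn h8, one_mul] at hr
  refine ⟨r, ?_, hr⟩
  rintro rfl
  have : 2 ∣ (n - a * s ^ 2) * (n - b * s ^ 2) := by rw [hr]; simp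
  exact (prime_two.dvd_or_dvd this).elim (not_two_dvd_sub hn hs2 _) (not_two_dvd_sub hn hs2 _)

lemma exists_sq_congr {m : ℕ} {n s e e' x : Cub ℤ} (hn : ¬ 2 ∣ n) (hs : 2 ^ (m + 2) ∣ s ^ 2)
    (hs2 : 2 ∣ s) (hx : n - e * s ^ 2 = x ^ 2) (h : ∃ x', n - e' * s ^ 2 = x' ^ 2) :
    ∃ u, n - e' * s ^ 2 = (x + 2 ^ (m + 1) * u) ^ 2 := by
  obtain ⟨x', hx'⟩ := h
  have h2 : ¬ 2 ∣ x := fun h2 => not_two_dvd_sub hn hs2 e (hx ▸ h2.pow two_ne_zero)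
  rcases exists_sign (m := m) (x := x') (y := x) h2 (by
    have : x' ^ 2 - x ^ 2 = (e - e') * s ^ 2 := by rw [← hx, ← hx']; ring
    rw [this]; exact hs.mul_left _) with ⟨u, hu⟩ | ⟨u, hu⟩
  · exact ⟨u, by rw [hx', ← hu]; ring⟩
  · exact ⟨-u, by rw [hx', mul_neg, ← hu]; ring⟩

/-- The `2`-adic infinite descent. -/
lemma no_solution (k : ℕ) : ∀ {n σ y : Cub ℤ}, ¬ 2 ∣ σ → 2 ∣ n - σ ^ 2 →
    cubic n ((2 ^ (k + 1) * σ) ^ 2) ≠ y ^ 2 := by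
  have h20 : (2 : Cub ℤ) ≠ 0 := prime_two.ne_zero
  induction k with
  | zero =>
    intro n σ y hσ hn h
    obtain ⟨n, σ, y, hσ, hn, h, hc⟩ := exists_coprime_solution hσ hn h
    rw [zero_add, pow_one] at h hc
    exact no_solution_level_one hσ hn h hc
  | succ k ih =>
    intro n σ y hσ hn h
    obtain ⟨n, σ, y, hσ, hn, h, hc⟩ := exists_coprime_solution hσ hn h
    have hn2 : ¬ 2 ∣ n := fun h2 => hσ (prime_two.dvd_of_dvd_pow ((dvd_sub_right h2).1 hn))
    have hs4 : 4 ∣ 2 ^ (k + 1 + 1) * σ := ⟨2 ^ k * σ, by ring⟩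
    have hs2 : 2 ∣ 2 ^ (k + 1 + 1) * σ := ⟨2 ^ (k + 1) * σ, by ring⟩
    obtain ⟨r₁, hr₁, h₁⟩ := mul_eq_sq_of_level (a := e₂) (b := e₃) (c := e₁) (y := y) hn2 hs4 hc
      e₂₁ e₃₁ (by rw [← h, cubic]; ring)
    obtain ⟨r₂, hr₂, h₂⟩ := mul_eq_sq_of_level (a := e₁) (b := e₃) (c := e₂) (y := y) hn2 hs4 hc
      e₁₂ e₃₂ (by rw [← h, cubic]; ring)
    obtain ⟨r₃, hr₃, h₃⟩ := mul_eq_sq_of_level (a := e₁) (b := e₂) (c := e₃) (y := y) hn2 hs4 hc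
      e₁₃ e₂_sub_e₃_dvd (by rw [← h, cubic])
    obtain ⟨x, hx⟩ := exists_eq_sq (a := n - e₁ * (2 ^ (k + 1 + 1) * σ) ^ 2) h₁ hr₁ (y := y)
      (by rw [← h, cubic])
    have hs : (2 : Cub ℤ) ^ (2 + 2) ∣ (2 ^ (k + 1 + 1) * σ) ^ 2 := ⟨(2 ^ k * σ) ^ 2, by ring⟩
    obtain ⟨u, hu⟩ := exists_sq_congr (e' := e₂) hn2 hs hs2 hx
      (exists_eq_sq h₂ hr₂ (y := y) (by rw [← h, cubic]; ring))
    obtain ⟨t, ht⟩ := exists_sq_congr (e' := e₃) hn2 hs hs2 hx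
      (exists_eq_sq h₃ hr₃ (y := y) (by rw [← h, cubic]; ring))
    obtain ⟨z, hz⟩ : ∃ z, z = (2 ^ k * σ) ^ 2 := ⟨_, rfl⟩
    have hz' : (2 ^ (k + 1 + 1) * σ) ^ 2 = 16 * z := by rw [hz]; ring
    have hz'' : (2 ^ (k + 1) * σ) ^ 2 = 4 * z := by rw [hz]; ring
    rw [hz'] at hx hu ht
    refine ih (n := n - 12 * e₁ * z + 4 * (u + t) * x + 16 * u * t) (σ := σ)
      (y := (x + 4 * u) * (x + 4 * t) * (x + 4 * u + 4 * t)) hσ ?_ ?_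
    · obtain ⟨q, hq⟩ := hn
      exact ⟨q - 6 * e₁ * z + 2 * (u + t) * x + 8 * u * t, by linear_combination hq⟩
    · have h40 : (4 : Cub ℤ) ≠ 0 := by
        have : (4 : Cub ℤ) = 2 ^ 2 := by norm_num
        rw [this]; exact pow_ne_zero 2 h20
      have f₁ : n - 12 * e₁ * z + 4 * (u + t) * x + 16 * u * t - e₁ * (4 * z) =
          (x + 4 * u) * (x + 4 * t) := by linear_combination hx
      have f₂ : n - 12 * e₁ * z + 4 * (u + t) * x + 16 * u * t - e₂ * (4 * z) =
          (x + 4 * u) * (x + 4 * u + 4 * t) :=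
        mul_left_cancel₀ h40 (by linear_combination 3 * hx + hu)
      have f₃ : n - 12 * e₁ * z + 4 * (u + t) * x + 16 * u * t - e₃ * (4 * z) =
          (x + 4 * t) * (x + 4 * u + 4 * t) :=
        mul_left_cancel₀ h40 (by linear_combination 3 * hx + ht)
      rw [cubic, hz'', f₁, f₂, f₃]
      ring

/-- First coefficient of the factorization of `U ^ 3 - 12 * U ^ 2 * V + 64 * V ^ 3`. -/
def κ₁ : Cub ℤ := ⟨1, 1, 0⟩
/-- Second coefficient of the factorization of `U ^ 3 - 12 * U ^ 2 * V + 64 * V ^ 3`. -/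
def κ₂ : Cub ℤ := ⟨1, 0, 1⟩
/-- Third coefficient of the factorization of `U ^ 3 - 12 * U ^ 2 * V + 64 * V ^ 3`. -/
def κ₃ : Cub ℤ := ⟨1, -1, -1⟩

lemma factorization (U V : Cub ℤ) :
    (U - 4 * κ₁ * V) * (U - 4 * κ₂ * V) * (U - 4 * κ₃ * V) =
      U ^ 3 - 12 * U ^ 2 * V + 64 * V ^ 3 := by
  have h1 : κ₁ + κ₂ + κ₃ = 3 := by ext <;> simp [κ₁, κ₂, κ₃]
  have h2 : κ₁ * κ₂ + κ₁ * κ₃ + κ₂ * κ₃ = 0 := by ext <;> simp [κ₁, κ₂, κ₃]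
  have h3 : κ₁ * κ₂ * κ₃ = -1 := by ext <;> simp [κ₁, κ₂, κ₃]
  linear_combination -4 * U ^ 2 * V * h1 + 16 * U * V ^ 2 * h2 - 64 * V ^ 3 * h3

lemma associated_pi_of_dvd_linear {U V a b p : Cub ℤ} (hU : ¬ 2 ∣ U) (hc : IsCoprime U V)
    (hab : a - b ∣ 3) (hp : Prime p) (h1 : p ∣ U - 4 * a * V) (h2 : p ∣ U - 4 * b * V) :
    Associated pi p := by
  have h3 : p ∣ 2 ^ 2 * ((a - b) * V) := by
    have := dvd_sub h2 h1
    convert this using 1; ring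
  rcases hp.dvd_or_dvd h3 with h | h
  · have h4 := (hp.irreducible.associated_of_dvd prime_two.irreducible
      (hp.dvd_of_dvd_pow h)).symm.dvd.trans h1
    exact (hU ((dvd_sub_left (Dvd.intro (2 * a * V) (by ring))).1 h4)).elim
  rcases hp.dvd_or_dvd h with h | h
  · exact associated_pi hp (h.trans hab)
  · have hn : p ∣ U := (dvd_sub_left (h.mul_left _)).1 h1
    exact (hp.not_isUnit (hc.isUnit_of_dvd' hn h)).elim

lemma exists_mul_eq_sq {U V y : Cub ℤ} (hU : ¬ 2 ∣ U) (hV : 2 ∣ V) (hc : IsCoprime U V)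
    (h : U ^ 3 - 12 * U ^ 2 * V + 64 * V ^ 3 = y ^ 2) :
    ∃ r, (U - 4 * κ₁ * V) * (U - 4 * κ₂ * V) = r ^ 2 := by
  have h13 : κ₁ - κ₃ ∣ 3 := ⟨⟨1, 1, 1⟩, by ext <;> simp [κ₁, κ₃]⟩
  have h23 : κ₂ - κ₃ ∣ 3 := ⟨⟨-1, 0, 1⟩, by ext <;> simp [κ₂, κ₃]⟩
  rw [← factorization] at h
  have hodd (a : Cub ℤ) : ¬ 2 ∣ U - 4 * a * V := fun h2 =>
    hU ((dvd_sub_left (Dvd.intro (2 * a * V) (by ring))).1 h2)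
  obtain ⟨e, i, j, k, r, hr⟩ := exists_rep (fun h0 => by
    have : 2 ∣ (U - 4 * κ₁ * V) * (U - 4 * κ₂ * V) := by simp [h0]
    exact (prime_two.dvd_or_dvd this).elim (hodd _) (hodd _)) h fun p hp h1 h2 =>
      (hp.dvd_or_dvd h1).elim
        (fun h3 => associated_pi_of_dvd_linear hU hc h13 hp h3 h2)
        (fun h3 => associated_pi_of_dvd_linear hU hc h23 hp h3 h2)
  refine ⟨r, ?_⟩
  rw [rep_eq_zero_of_sq (r := r) hU, one_mul] at hr
  · exact hr
  · rw [← hr]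
    obtain ⟨z, rfl⟩ := hV
    exact ⟨-(κ₁ + κ₂) * U * z + 8 * κ₁ * κ₂ * z ^ 2, by ring⟩

/-- The point on the elliptic curve attached to a square value of the binary form. -/
lemma cubic_eq_sq {p q : ℤ} {β L : Cub ℤ} (hL : 2 * L = (p + q) * β + (p - q) ^ 3)
    (hβ : (p ^ 2 + q ^ 2 - 4 * κ₁ * (p * q)) * (p ^ 2 + q ^ 2 - 4 * κ₂ * (p * q)) = β ^ 2) :
    ∃ n y, n = L ^ 2 + (e₁ + e₂ + e₃) * (p * q * (p - q)) ^ 2 + 4 * e₁ * (p * q) ^ 3 ∧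
      cubic n ((p * q * (p - q)) ^ 2) = y ^ 2 := by
  refine ⟨_, 2 * e₁ * (p * q * (p - q)) ^ 3 + L *
    (L ^ 2 + (e₁ + e₂ + e₃) * (p * q * (p - q)) ^ 2 + 4 * e₁ * (p * q) ^ 3), rfl, ?_⟩
  have h4 : (2 : Cub ℤ) ^ 2 ≠ 0 := pow_ne_zero 2 prime_two.ne_zero
  obtain ⟨γ, hγ⟩ : ∃ γ : Cub ℤ, γ = ⟨0, -1, -1⟩ := ⟨_, rfl⟩
  have g1 : κ₁ + κ₂ = 2 - γ := by rw [hγ]; ext <;> simp [κ₁, κ₂]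
  have g2 : e₁ * e₂ + e₁ * e₃ + e₂ * e₃ = -4 * e₁ * γ := by
    rw [hγ]; ext <;> simp [e₁, e₂, e₃]
  have g3 : e₂ * e₃ = -4 * e₁ := by ext <;> simp [e₁, e₂, e₃]
  have hK : L ^ 2 - (p - q) ^ 3 * L + (e₁ + e₂ + e₃) * (p * q * (p - q)) ^ 2
      + 4 * e₁ * (p * q) ^ 3 = γ * (p * q) * (p - q) ^ 4 := by
    have hC : (p + q : Cub ℤ) ^ 2 * ((p ^ 2 + q ^ 2 - 4 * κ₁ * (p * q)) *
        (p ^ 2 + q ^ 2 - 4 * κ₂ * (p * q))) - (p - q) ^ 6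
        + 4 * ((e₁ + e₂ + e₃) * (p * q * (p - q)) ^ 2) + 16 * e₁ * (p * q) ^ 3 =
        4 * (γ * (p * q) * (p - q) ^ 4) := by
      rw [hγ]
      ext <;> simp [pow_succ, e₁, e₂, e₃, κ₁, κ₂] <;> ring
    refine mul_left_cancel₀ h4 ?_
    linear_combination (2 * L - (p - q) ^ 3 + (p + q) * β) * hL - (p + q) ^ 2 * hβ + hC
  generalize (p : Cub ℤ) = p at *
  generalize (q : Cub ℤ) = q at *
  obtain ⟨n, hn⟩ : ∃ n, n = L ^ 2 + (e₁ + e₂ + e₃) * (p * q * (p - q)) ^ 2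
    + 4 * e₁ * (p * q) ^ 3 := ⟨_, rfl⟩
  rw [← hn, cubic]
  linear_combination n ^ 2 * hn + (p * q) ^ 4 * (p - q) ^ 4 * n * g2
    - e₁ * (p * q * (p - q)) ^ 6 * g3 + 4 * e₁ * (p * q) ^ 3 * n * (hK + hn)

lemma two_dvd_intCast (z : ℤ) : (2 : Cub ℤ) ∣ z ↔ 2 ∣ z := by simp [two_dvd_iff]

/-- The binary sextic form attached to the curve is a square only trivially. -/
theorem eq_zero_of_sextic_eq_sq {p q y : ℤ} (hp : ¬ 2 ∣ p) (hq : 2 ∣ q) (hpq : IsCoprime p q)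
    (h : (p ^ 2 + q ^ 2) ^ 3 - 12 * (p ^ 2 + q ^ 2) ^ 2 * (p * q) + 64 * (p * q) ^ 3 = y ^ 2) :
    q = 0 := by
  by_contra hq0
  have hfin : FiniteMultiplicity 2 q := Int.finiteMultiplicity_iff.2 ⟨by decide, hq0⟩
  obtain ⟨q₀, hm, hq₀⟩ := hfin.exists_eq_pow_mul_and_not_dvd
  generalize multiplicity 2 q = m at hm
  obtain ⟨k, rfl⟩ : ∃ k, m = k + 1 := by
    refine Nat.exists_eq_succ_of_ne_zero ?_
    rintro rfl
    rw [pow_zero, one_mul] at hm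
    exact hq₀ (hm ▸ hq)
  have hQ : (q : Cub ℤ) = 2 ^ (k + 1) * q₀ := by rw [hm]; push_cast; rfl
  have hU : ¬ (2 : Cub ℤ) ∣ p ^ 2 + q ^ 2 := by
    have : ¬ (2 : ℤ) ∣ p ^ 2 + q ^ 2 := fun h2 =>
      hp (Int.prime_two.dvd_of_dvd_pow ((dvd_add_left (hq.pow two_ne_zero)).1 h2))
    rw [← two_dvd_intCast] at this
    exact_mod_cast this
  have hq2 : (2 : Cub ℤ) ∣ q := (two_dvd_intCast q).2 hq
  have hc : IsCoprime ((p : Cub ℤ) ^ 2 + q ^ 2) (p * q) := by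
    have h1 : IsCoprime (p ^ 2 + q ^ 2) (p * q) := by
      obtain ⟨a, b, hab⟩ := hpq.pow (m := 2) (n := 2)
      refine IsCoprime.mul_right ?_ ?_
      · exact (IsCoprime.pow_right_iff two_pos).1 ⟨b, a - b, by linear_combination hab⟩
      · exact (IsCoprime.pow_right_iff two_pos).1 ⟨a, b - a, by linear_combination hab⟩
    have := h1.map (Int.castRingHom (Cub ℤ))
    simpa using this
  have h' := congrArg (Int.cast : ℤ → Cub ℤ) h
  push_cast at h'
  obtain ⟨β, hβ⟩ := exists_mul_eq_sq hU (hq2.mul_left _) hc h'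
  have hβ' : (2 : Cub ℤ) ^ (k + 1 + 2) ∣ β ^ 2 - (p ^ 2 + q ^ 2) ^ 2 := by
    rw [← hβ]
    refine Dvd.dvd.trans (b := 4 * (p * q : Cub ℤ)) ⟨p * q₀, by rw [hQ]; ring⟩
      ⟨-(κ₁ + κ₂) * (p ^ 2 + q ^ 2) + 4 * κ₁ * κ₂ * (p * q), by ring⟩
  obtain ⟨β, t, hβ, ht⟩ : ∃ β t : Cub ℤ, (p ^ 2 + q ^ 2 - 4 * κ₁ * (p * q)) *
      (p ^ 2 + q ^ 2 - 4 * κ₂ * (p * q)) = β ^ 2 ∧ β = p ^ 2 + q ^ 2 + 2 ^ (k + 2) * t := by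
    rcases exists_sign hU hβ' with ⟨t, ht⟩ | ⟨t, ht⟩
    · exact ⟨β, t, hβ, by linear_combination ht⟩
    · exact ⟨-β, -t, by rw [hβ]; ring, by linear_combination -ht⟩
  obtain ⟨n, z, hn, hz⟩ := cubic_eq_sq (p := p) (q := q) (β := β)
    (L := p ^ 3 - p ^ 2 * q + 2 * p * q ^ 2 + 2 ^ (k + 1) * ((p + q) * t))
    (by rw [ht]; ring) hβ
  have hp1 : ∃ a : ℤ, p = 2 * a + 1 := by
    rwa [← even_iff_two_dvd, Int.not_even_iff_odd] at hp
  have hpq2 : ¬ 2 ∣ p - q := fun h2 => hp ((dvd_sub_left hq).1 h2)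
  have hσ : ¬ (2 : ℤ) ∣ p * q₀ * (p - q) := fun h2 =>
    (Int.prime_two.dvd_or_dvd h2).elim
      (fun h2 => (Int.prime_two.dvd_or_dvd h2).elim hp hq₀) hpq2
  obtain ⟨c, hc1⟩ : ∃ c : ℤ, p * q₀ * (p - q) = 2 * c + 1 := by
    rwa [← even_iff_two_dvd, Int.not_even_iff_odd] at hσ
  refine no_solution k (n := n) (σ := (p * q₀ * (p - q) : ℤ)) (y := z)
    ((two_dvd_intCast _).not.2 hσ) ?_ ?_
  · obtain ⟨a, ha⟩ := hp1
    obtain ⟨b, hb⟩ := hq2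
    have ha' : (p : Cub ℤ) = 2 * a + 1 := by rw [ha]; push_cast; rfl
    obtain ⟨l, hl⟩ : ∃ l : Cub ℤ, p ^ 3 - p ^ 2 * q + 2 * p * q ^ 2 +
        2 ^ (k + 1) * ((p + q) * t) = 2 * l + 1 :=
      ⟨4 * a ^ 3 + 6 * a ^ 2 + 3 * a - p ^ 2 * b + p * q ^ 2 + 2 ^ k * ((p + q) * t), by
        rw [hb, ha']; ring⟩
    rw [hn, hl, hc1, hb]
    push_cast
    exact ⟨2 * l ^ 2 + 2 * l + 2 * (e₁ + e₂ + e₃) * (p * b * (p - 2 * b)) ^ 2 +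
      16 * e₁ * (p * b) ^ 3 - 2 * c ^ 2 - 2 * c, by ring⟩
  · rw [← hz]
    congr 2
    push_cast
    rw [hQ]
    ring

end Cub

lemma GaussianInt.exists_eq_cube_of_isUnit {u : GaussianInt} (hu : IsUnit u) : ∃ x, u = x ^ 3 := by
  refine ⟨u ^ 3, ?_⟩
  have h := Zsqrtd.norm_eq_one_iff' (by norm_num) u |>.2 hu
  rw [Zsqrtd.norm_def] at h
  obtain ⟨x, y⟩ := u
  simp only at h
  replace h : x ^ 2 + y ^ 2 = 1 := by linear_combination h
  have hx : x ^ 2 ≤ 1 ^ 2 := by nlinarith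
  have hy : y ^ 2 ≤ 1 ^ 2 := by nlinarith
  obtain ⟨hx1, hx2⟩ := abs_le.1 (abs_le_of_sq_le_sq hx zero_le_one)
  obtain ⟨hy1, hy2⟩ := abs_le.1 (abs_le_of_sq_le_sq hy zero_le_one)
  interval_cases x <;> interval_cases y <;> first | omega | decide

lemma exists_of_sq_add_sq_eq_cube {a b M : ℤ} (ha : ¬ 2 ∣ a) (hb : 2 ∣ b) (hab : IsCoprime a b)
    (h : a ^ 2 + b ^ 2 = M ^ 3) :
    ∃ p q, ¬ 2 ∣ p ∧ 2 ∣ q ∧ IsCoprime p q ∧ a = p ^ 3 - 3 * p * q ^ 2 ∧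
      b = 3 * p ^ 2 * q - q ^ 3 := by
  obtain ⟨k, hk⟩ : ∃ k : ℤ, a ^ 2 + b ^ 2 = 2 * k + 1 := by
    refine Int.not_even_iff_odd.1 fun h2 => ha (Int.prime_two.dvd_of_dvd_pow (n := 2) ?_)
    exact (dvd_add_left (hb.pow two_ne_zero)).1 (even_iff_two_dvd.1 h2)
  have hz : (⟨a, b⟩ : GaussianInt) * ⟨a, -b⟩ = (M : GaussianInt) ^ 3 := by
    have : ((M : GaussianInt)) ^ 3 = ((M ^ 3 : ℤ) : GaussianInt) := by push_cast; rfl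
    rw [this, ← h]
    ext
    · simp only [Zsqrtd.re_mul, Zsqrtd.re_intCast]; ring
    · simp only [Zsqrtd.im_mul, Zsqrtd.im_intCast]; ring
  have hc : IsCoprime (⟨a, b⟩ : GaussianInt) ⟨a, -b⟩ := by
    obtain ⟨u, v, huv⟩ := hab
    refine ⟨⟨a, -b⟩ - ⟨k * u, -(k * v)⟩, -⟨k * u, k * v⟩, ?_⟩
    ext
    · simp
      linear_combination hk - 2 * k * huv
    · simp
      ring
  obtain ⟨d, u, hu⟩ := exists_associated_pow_of_mul_eq_pow' hc hz
  obtain ⟨x, hx⟩ := GaussianInt.exists_eq_cube_of_isUnit u.isUnit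
  rw [hx, ← mul_pow] at hu
  generalize d * x = z at hu
  obtain ⟨p, q⟩ := z
  have h1 : a = p ^ 3 - 3 * p * q ^ 2 := by
    have := congrArg Zsqrtd.re hu
    simp [pow_succ] at this
    linear_combination -this
  have h2 : b = 3 * p ^ 2 * q - q ^ 3 := by
    have := congrArg Zsqrtd.im hu
    simp [pow_succ] at this
    linear_combination -this
  have hpa : p ∣ a := ⟨p ^ 2 - 3 * q ^ 2, by rw [h1]; ring⟩
  have hqb : q ∣ b := ⟨3 * p ^ 2 - q ^ 2, by rw [h2]; ring⟩
  have hp : ¬ 2 ∣ p := fun h => ha (h.trans hpa)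
  refine ⟨p, q, hp, ?_, (hab.of_isCoprime_of_dvd_left hpa).of_isCoprime_of_dvd_right hqb, h1, h2⟩
  by_contra hq
  obtain ⟨p', rfl⟩ := Int.not_even_iff_odd.1 (even_iff_two_dvd.not.2 hp)
  obtain ⟨q', rfl⟩ := Int.not_even_iff_odd.1 (even_iff_two_dvd.not.2 hq)
  exact ha ⟨4 * p' ^ 3 + 6 * p' ^ 2 + 3 * p' - 12 * p' * q' ^ 2 - 12 * p' * q' - 3 * p'
    - 6 * q' ^ 2 - 6 * q' - 1, by rw [h1]; ring⟩

lemma isCoprime_of_forall_prime {a b : ℤ} (h : ∀ p, Prime p → p ∣ a → ¬ p ∣ b) :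
    IsCoprime a b := by
  by_cases h0 : a = 0 ∧ b = 0
  · exact (h 2 Int.prime_two (by simp [h0.1]) (by simp [h0.2])).elim
  · exact isCoprime_of_prime_dvd h0 fun p hp => h p hp

lemma not_three_dvd_of_sq_add_sq_eq_cube {s t M : ℤ} (hst : IsCoprime s t)
    (h : (s * (s + 2 * t)) ^ 2 + (2 * t * (s - t)) ^ 2 = M ^ 3) : ¬ 3 ∣ s - t := by
  rintro ⟨k, hk⟩
  obtain rfl : s = t + 3 * k := by linarith
  have ht : ¬ 3 ∣ t := fun h3 => Int.prime_three.not_isUnit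
    (hst.isUnit_of_dvd' (dvd_add h3 (dvd_mul_right _ _)) h3)
  obtain ⟨N, rfl⟩ : 3 ∣ M := Int.prime_three.dvd_of_dvd_pow (n := 3)
    ⟨3 * (((t + 3 * k) * (t + k)) ^ 2 + (2 * t * k) ^ 2), by rw [← h]; ring⟩
  have h1 : ((t + 3 * k) * (t + k)) ^ 2 + (2 * t * k) ^ 2 = 3 * N ^ 3 := by linarith
  have h2 := congrArg (Int.cast : ℤ → ZMod 3) h1
  push_cast at h2
  replace ht : (t : ZMod 3) ≠ 0 := fun h0 => ht ((ZMod.intCast_zmod_eq_zero_iff_dvd t 3).1 h0)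
  revert h2 ht
  generalize (t : ZMod 3) = t
  generalize (k : ZMod 3) = k
  generalize (N : ZMod 3) = N
  revert t k N
  decide

lemma eq_zero_of_sq_add_sq_eq_cube {s t M : ℤ} (hs : ¬ 2 ∣ s) (hst : IsCoprime s t)
    (h : (s ^ 2 - 2 * t ^ 2 + 2 * s * t) ^ 2 + 2 * (2 * s * t) ^ 2 = M ^ 3) : t = 0 := by
  have h' : (s * (s + 2 * t)) ^ 2 + (2 * t * (s - t)) ^ 2 = M ^ 3 := by rw [← h]; ring
  have h3 := not_three_dvd_of_sq_add_sq_eq_cube hst h'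
  have hs2 : ¬ 2 ∣ s + 2 * t := fun h2 => hs ((dvd_add_left (dvd_mul_right _ _)).1 h2)
  have hc {p : ℤ} (hp : Prime p) (h1 : p ∣ s) (h2 : p ∣ t) : False :=
    hp.not_isUnit (hst.isUnit_of_dvd' h1 h2)
  have hab : IsCoprime (s * (s + 2 * t)) (2 * t * (s - t)) := by
    refine isCoprime_of_forall_prime fun p hp ha hb => ?_
    have hp2 : ¬ p ∣ 2 := fun h2 => by
      have := (hp.irreducible.associated_of_dvd Int.prime_two.irreducible h2).symm.dvd.trans ha
      exact (Int.prime_two.dvd_or_dvd this).elim hs hs2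
    rcases hp.dvd_or_dvd ha with ha | ha
    · rcases hp.dvd_or_dvd hb with hb | hb
      · exact hc hp ha ((hp.dvd_or_dvd hb).resolve_left hp2)
      · exact hc hp ha ((dvd_sub_right ha).1 hb)
    · rcases hp.dvd_or_dvd hb with hb | hb
      · have ht := (hp.dvd_or_dvd hb).resolve_left hp2
        exact hc hp ((dvd_add_left (ht.mul_left 2)).1 ha) ht
      · have h3t : p ∣ 3 * t := by
          have : 3 * t = s + 2 * t - (s - t) := by ring
          rw [this]; exact dvd_sub ha hb
        rcases hp.dvd_or_dvd h3t with h4 | h4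
        · exact h3 ((hp.irreducible.associated_of_dvd
            Int.prime_three.irreducible h4).symm.dvd.trans hb)
        · exact hc hp ((dvd_add_left (h4.mul_left 2)).1 ha) h4
  obtain ⟨p, q, hp, hq, hpq, ha, hb⟩ := exists_of_sq_add_sq_eq_cube
    (fun h2 => (Int.prime_two.dvd_or_dvd h2).elim hs hs2) (Dvd.intro (t * (s - t)) (by ring)) hab h'
  have hq0 := Cub.eq_zero_of_sextic_eq_sq (y := s ^ 2 - 2 * s * t - 2 * t ^ 2) hp hq hpq (by
    obtain ⟨a, hA⟩ : ∃ a, a = s * (s + 2 * t) := ⟨_, rfl⟩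
    obtain ⟨b, hB⟩ : ∃ b, b = 2 * t * (s - t) := ⟨_, rfl⟩
    have : (s ^ 2 - 2 * s * t - 2 * t ^ 2) ^ 2 = a ^ 2 - 4 * a * b + b ^ 2 := by
      rw [hA, hB]; ring
    rw [this, hA, hB, ha, hb]
    ring)
  rw [hq0] at hb
  have hb' : t * (s - t) = 0 := by linarith
  exact (mul_eq_zero.1 hb').resolve_right fun h0 => h3 (by rw [h0]; exact dvd_zero 3)

lemma exists_of_mul_eq_two_mul_sq {u w r : ℤ} (hr : r ≠ 0) (hc : IsCoprime u w) (hu : 2 ∣ u)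
    (h : u * w = 2 * r ^ 2) :
    ∃ s t ε : ℤ, ε ^ 2 = 1 ∧ u = ε * (2 * t ^ 2) ∧ w = ε * s ^ 2 ∧ r = ε * (s * t) := by
  obtain ⟨u, rfl⟩ := hu
  replace h : u * w = r ^ 2 := by linarith
  have hc' : IsCoprime u w := hc.of_mul_left_right
  have key {ε s t : ℤ} (hε : ε ^ 2 = 1) (hu : u = ε * t ^ 2) (hw : w = ε * s ^ 2) :
      ∃ s t ε : ℤ, ε ^ 2 = 1 ∧ 2 * u = ε * (2 * t ^ 2) ∧ w = ε * s ^ 2 ∧ r = ε * (s * t) := by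
    have h1 : r ^ 2 = (ε * (s * t)) ^ 2 := by
      rw [← h, hu, hw]; ring
    rcases sq_eq_sq_iff_eq_or_eq_neg.1 h1 with h1 | h1
    · exact ⟨s, t, ε, hε, by rw [hu]; ring, hw, h1⟩
    · exact ⟨s, -t, ε, hε, by rw [hu]; ring, hw, by rw [h1]; ring⟩
  have hr2 : 0 < r ^ 2 := by positivity
  obtain ⟨t, ht | ht⟩ := Int.sq_of_isCoprime hc' h <;>
  obtain ⟨s, hs | hs⟩ := Int.sq_of_isCoprime hc'.symm (by rwa [mul_comm] at h)
  · exact key (ε := 1) (by norm_num) (by simpa using ht) (by simpa using hs)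
  · rw [ht, hs] at h
    nlinarith [sq_nonneg (s * t)]
  · rw [ht, hs] at h
    nlinarith [sq_nonneg (s * t)]
  · exact key (ε := -1) (by norm_num) (by simpa using ht) (by simpa using hs)

lemma eq_zero_of_sextic_norm {A r y M : ℤ} (hA : ¬ 2 ∣ A) (hAr : IsCoprime A r)
    (hM : (A + 2 * r) ^ 2 + 2 * (2 * r) ^ 2 = M ^ 3) (h : A ^ 2 + 2 * (2 * r) ^ 2 = y ^ 2) :
    r = 0 := by
  by_contra hr
  obtain ⟨a, rfl⟩ := Int.not_even_iff_odd.1 (even_iff_two_dvd.not.2 hA)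
  have hy : ¬ 2 ∣ y := fun h2 => hA (Int.prime_two.dvd_of_dvd_pow (n := 2)
    ((dvd_add_left (c := 2 * (2 * r) ^ 2) (dvd_mul_right _ _)).1
      (by rw [h]; exact h2.pow two_ne_zero)))
  have key {w u : ℤ} (hw : w - u = 2 * a + 1) (hu : 2 ∣ u) (huw : u * w = 2 * r ^ 2) : False := by
    have hc : IsCoprime u w := isCoprime_of_forall_prime fun p hp h1 h2 => by
      have hpA : p ∣ 2 * a + 1 := hw ▸ dvd_sub h2 h1
      have hp2 : ¬ p ∣ 2 := fun h2 => hA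
        ((hp.irreducible.associated_of_dvd Int.prime_two.irreducible h2).symm.dvd.trans hpA)
      have hpr : p ∣ 2 * r ^ 2 := huw ▸ h1.mul_right w
      exact hp.not_isUnit (hAr.isUnit_of_dvd' hpA
        (hp.dvd_of_dvd_pow ((hp.dvd_or_dvd hpr).resolve_left hp2)))
    obtain ⟨s, t, ε, hε, hu', hw', hr'⟩ := exists_of_mul_eq_two_mul_sq hr hc hu huw
    have hst : IsCoprime s t := by
      refine isCoprime_of_forall_prime fun p hp h1 h2 => hp.not_isUnit (hc.isUnit_of_dvd' ?_ ?_)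
      · rw [hu']; exact ((h2.pow two_ne_zero).mul_left _).mul_left _
      · rw [hw']; exact (h1.pow two_ne_zero).mul_left _
    have hs : ¬ 2 ∣ s := fun h2 => Int.prime_two.not_isUnit (hc.isUnit_of_dvd' hu
      (by rw [hw']; exact (h2.pow two_ne_zero).mul_left _))
    have ht := eq_zero_of_sq_add_sq_eq_cube hs hst (M := M) (by
      rw [← hM, ← hw, hr', hw', hu']
      linear_combination (-(s ^ 2 - 2 * t ^ 2 + 2 * s * t) ^ 2 - 2 * (2 * s * t) ^ 2) * hε)
    exact hr (by rw [hr', ht]; ring)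
  obtain ⟨b, rfl⟩ := Int.not_even_iff_odd.1 (even_iff_two_dvd.not.2 hy)
  have huw : (b - a) * (b + a + 1) = 2 * r ^ 2 := by linarith
  rcases Int.even_or_odd' (b - a) with ⟨c, hc | hc⟩
  · exact key (w := b + a + 1) (u := b - a) (by ring) ⟨c, hc⟩ huw
  · exact key (w := a - b) (u := -(b + a + 1)) (by ring) ⟨-(c + a + 1), by linarith⟩
      (by linarith)

/-- The homogeneous form of the equation has no primitive solution with nonzero denominator. -/
lemma eq_zero_of_sq_eq_sextic {m n y : ℤ} (hmn : IsCoprime m n)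
    (h : y ^ 2 = m ^ 6 - 6 * m ^ 5 * n + 15 * m ^ 4 * n ^ 2 + 40 * m ^ 3 * n ^ 3 - 24 * m * n ^ 5
      + 12 * n ^ 6) : n = 0 := by
  have hm : ¬ 2 ∣ m := by
    rintro ⟨k, rfl⟩
    have hn : ¬ 2 ∣ n := fun h2 =>
      Int.prime_two.not_isUnit (hmn.isUnit_of_dvd' (dvd_mul_right _ _) h2)
    obtain ⟨l, rfl⟩ := Int.not_even_iff_odd.1 (even_iff_two_dvd.not.2 hn)
    obtain ⟨z, rfl⟩ : 2 ∣ y := Int.prime_two.dvd_of_dvd_pow (n := 2)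
      ⟨32 * k ^ 6 - 96 * k ^ 5 * (2 * l + 1) + 120 * k ^ 4 * (2 * l + 1) ^ 2
        + 160 * k ^ 3 * (2 * l + 1) ^ 3 - 24 * k * (2 * l + 1) ^ 5 + 6 * (2 * l + 1) ^ 6,
        by rw [h]; ring⟩
    have h1 : z ^ 2 = 16 * k ^ 6 - 48 * k ^ 5 * (2 * l + 1) + 60 * k ^ 4 * (2 * l + 1) ^ 2
        + 80 * k ^ 3 * (2 * l + 1) ^ 3 - 12 * k * (2 * l + 1) ^ 5 + 3 * (2 * l + 1) ^ 6 := by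
      linarith
    have h2 := congrArg (Int.cast : ℤ → ZMod 4) h1
    push_cast at h2
    revert h2
    generalize (k : ZMod 4) = k
    generalize (l : ZMod 4) = l
    generalize (z : ZMod 4) = z
    revert k l z
    decide
  have hn : 2 ∣ n := by
    by_contra hn
    obtain ⟨k, rfl⟩ := Int.not_even_iff_odd.1 (even_iff_two_dvd.not.2 hm)
    obtain ⟨l, rfl⟩ := Int.not_even_iff_odd.1 (even_iff_two_dvd.not.2 hn)
    have h2 := congrArg (Int.cast : ℤ → ZMod 4) h
    push_cast at h2
    revert h2
    generalize (k : ZMod 4) = k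
    generalize (l : ZMod 4) = l
    generalize (y : ZMod 4) = y
    revert k l y
    decide
  obtain ⟨l, rfl⟩ := hn
  have hodd : ¬ 2 ∣ m ^ 3 - 6 * m * (2 * l) ^ 2 - (3 * m ^ 2 * (2 * l) - 2 * (2 * l) ^ 3) := by
    intro h2
    refine hm (Int.prime_two.dvd_of_dvd_pow (n := 3) ?_)
    rw [show m ^ 3 - 6 * m * (2 * l) ^ 2 - (3 * m ^ 2 * (2 * l) - 2 * (2 * l) ^ 3) =
      m ^ 3 - 2 * (12 * m * l ^ 2 + 3 * m ^ 2 * l - 8 * l ^ 3) by ring] at h2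
    exact (dvd_sub_left (dvd_mul_right _ _)).1 h2
  have hc : IsCoprime (m ^ 3 - 6 * m * (2 * l) ^ 2 - (3 * m ^ 2 * (2 * l) - 2 * (2 * l) ^ 3))
      (3 * m ^ 2 * l - 8 * l ^ 3) := by
    refine isCoprime_of_forall_prime fun p hp h1 h2 => ?_
    have hp2 : ¬ p ∣ 2 := fun h2 => hodd
      ((hp.irreducible.associated_of_dvd Int.prime_two.irreducible h2).symm.dvd.trans h1)
    have h3 : p ∣ m ^ 2 + 8 * l ^ 2 := hp.dvd_of_dvd_pow (n := 3) (by
      rw [show (m ^ 2 + 8 * l ^ 2) ^ 3 =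
        (m ^ 3 - 6 * m * (2 * l) ^ 2 - (3 * m ^ 2 * (2 * l) - 2 * (2 * l) ^ 3)) *
        (m ^ 3 - 6 * m * (2 * l) ^ 2 + (3 * m ^ 2 * (2 * l) - 2 * (2 * l) ^ 3)) +
        (3 * m ^ 2 * l - 8 * l ^ 3) * (12 * (3 * m ^ 2 * l - 8 * l ^ 3)) by ring]
      exact dvd_add (h1.mul_right _) (h2.mul_right _))
    have h4 : p ∣ l := by
      have : p ∣ 2 ^ 5 * l ^ 3 := by
        rw [show 2 ^ 5 * l ^ 3 = 3 * l * (m ^ 2 + 8 * l ^ 2) - (3 * m ^ 2 * l - 8 * l ^ 3) by ring]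
        exact dvd_sub (h3.mul_left _) h2
      exact (hp.dvd_or_dvd this).elim (fun h => (hp2 (hp.dvd_of_dvd_pow h)).elim)
        hp.dvd_of_dvd_pow
    have h5 : p ∣ m := hp.dvd_of_dvd_pow
      ((dvd_add_left ((h4.pow two_ne_zero).mul_left 8)).1 h3)
    exact hp.not_isUnit (hmn.isUnit_of_dvd' h5 (h4.mul_left 2))
  have hr := eq_zero_of_sextic_norm (y := y) (M := m ^ 2 + 8 * l ^ 2) hodd hc (by ring)
    (by rw [h]; ring)
  have hr' : l * (3 * m ^ 2 - 8 * l ^ 2) = 0 := by linarith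
  rcases mul_eq_zero.1 hr' with h0 | h0
  · rw [h0, mul_zero]
  · refine (hm (Int.prime_two.dvd_of_dvd_pow (n := 2) ?_)).elim
    exact ⟨4 * l ^ 2 - m ^ 2, by linarith⟩

/-- The genus-two hyperelliptic curve
`C₂ : Y² = X⁶ - 6X⁵ + 15X⁴ + 40X³ - 24X + 12` has no affine rational points (its only
rational points are the two points at infinity). -/
theorem no_rational_points_C2 (X Y : ℚ) :
    Y ^ 2 ≠ X ^ 6 - 6 * X ^ 5 + 15 * X ^ 4 + 40 * X ^ 3 - 24 * X + 12 := by
  intro h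
  obtain ⟨m, n, hn0, hmn, rfl⟩ : ∃ m n : ℤ, n ≠ 0 ∧ IsCoprime m n ∧ X = m / n :=
    ⟨X.num, X.den, by exact_mod_cast X.den_nz, Int.isCoprime_iff_nat_coprime.2 X.reduced,
      by exact_mod_cast X.num_div_den.symm⟩
  have hn : (n : ℚ) ≠ 0 := by exact_mod_cast hn0
  obtain ⟨y, hy⟩ := Rat.isSquare_intCast_iff.1 (⟨Y * n ^ 3, by
    have : (Y * n ^ 3) * (Y * n ^ 3) = Y ^ 2 * n ^ 6 := by ring
    rw [this, h]
    push_cast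
    field_simp⟩ : IsSquare (((m ^ 6 - 6 * m ^ 5 * n + 15 * m ^ 4 * n ^ 2 + 40 * m ^ 3 * n ^ 3
      - 24 * m * n ^ 5 + 12 * n ^ 6 : ℤ)) : ℚ))
  exact hn0 (eq_zero_of_sq_eq_sextic hmn (by rw [hy, pow_two]))
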